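/- Let N ≥ 3 and a_1 > a_2 > ... > a_N > 0. Let Ω = {x ∈ ℝ^N : Σ_{j=1}^N x_j²/a_j² ≤ 1} with boundary Γ, let E and μ be the focal ellipsoid and its mother body measure, and set C_N = 1/vol(S^{N−1}), B = C_N ∫_Ω |y|^{2−N} dy, and μ̂(x) = C_N ∫_E |x − y|^{2−N} dμ(y). Define V(x) = (1/B)(μ̂(x) − (1/2) Σ_{i=1}^N x_i·(∂μ̂/∂x_i)(x)). Then: (i) V is harmonic on ℝ^N \ E (in particular on ℝ^N \ closure(Ω)); (ii) V(x) = 1 for every x ∈ Γ; and (iii) V(x) → 0 as |x| → ∞. Hence V is the equilibrium potential of Ω. -/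

import Mathlib

open MeasureTheory

/-- The Laplacian of `u : ℝᴺ → ℝ` at `x`, as the sum of second partial derivatives. -/
noncomputable def lap {N : ℕ} (u : (Fin N → ℝ) → ℝ) (x : Fin N → ℝ) : ℝ :=
  ∑ i, fderiv ℝ (fun y => fderiv ℝ u y (Pi.single i 1)) x (Pi.single i 1)

section Preliminaries

open Set Filter Topology

section ParametricIntegral

variable {Y G : Type*} [TopologicalSpace Y] [MeasurableSpace Y] [OpensMeasurableSpace Y]
  [NormedAddCommGroup G] [NormedSpace ℝ G] {ν : Measure Y} [IsFiniteMeasureOnCompacts ν]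
  {S : Set Y}

theorem ContinuousOn.section_right {X Y G : Type*} [TopologicalSpace X] [TopologicalSpace Y]
    [TopologicalSpace G] {f : X → Y → G} {U : Set X} {S : Set Y}
    (hf : ContinuousOn (Function.uncurry f) (U ×ˢ S)) {x : X} (hx : x ∈ U) :
    ContinuousOn (f x) S :=
  hf.comp (f := fun y => (x, y)) (by fun_prop) fun _ hy => ⟨hx, hy⟩

theorem continuousOn_setIntegral_of_isCompact {X : Type*} [TopologicalSpace X]
    [FirstCountableTopology X] {U : Set X} (hS : IsCompact S) (hSm : MeasurableSet S)
    {f : X → Y → G} (hf : ContinuousOn (Function.uncurry f) (U ×ˢ S)) :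
    ContinuousOn (fun x => ∫ y in S, f x y ∂ν) U := by
  intro x₀ hx₀
  obtain ⟨C, hC⟩ := hS.exists_bound_of_continuousOn (hf.section_right hx₀)
  have hbound : ∀ᶠ x in 𝓝[U] x₀, ∀ y ∈ S, ‖f x y‖ ≤ C + 1 := by
    obtain ⟨v, hv, h⟩ := hS.mem_uniformity_of_prod hf hx₀ (Metric.dist_mem_uniformity one_pos)
    filter_upwards [hv] with x hx y hy
    have h1 : dist (f x y) (f x₀ y) < 1 := h x hx y hy
    have h2 := norm_le_norm_add_norm_sub' (f x y) (f x₀ y)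
    rw [dist_eq_norm] at h1
    linarith [hC y hy]
  refine tendsto_integral_filter_of_dominated_convergence (fun _ => C + 1) ?_ ?_ ?_ ?_
  · filter_upwards [self_mem_nhdsWithin] with x hx
    exact (hf.section_right hx).aestronglyMeasurable_of_isCompact hS hSm
  · filter_upwards [hbound] with x hx
    filter_upwards [ae_restrict_mem hSm] with y hy
    exact hx y hy
  · have : IsFiniteMeasure (ν.restrict S) := ⟨by simpa using hS.measure_lt_top⟩
    exact integrable_const _
  · filter_upwards [ae_restrict_mem hSm] with y hy
    have := hf (x₀, y) ⟨hx₀, hy⟩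
    exact this.tendsto.comp (f := fun x => (x, y))
      (tendsto_nhdsWithin_iff.2 ⟨(Continuous.tendsto (by fun_prop) x₀).mono_left nhdsWithin_le_nhds,
        by filter_upwards [self_mem_nhdsWithin] with x hx using ⟨hx, hy⟩⟩)

theorem hasFDerivAt_setIntegral_of_isCompact {H : Type*} [NormedAddCommGroup H]
    [NormedSpace ℝ H] {U : Set H} (hU : IsOpen U) (hS : IsCompact S) (hSm : MeasurableSet S)
    {f : H → Y → G} {f' : H → Y → H →L[ℝ] G}
    (hf : ContinuousOn (Function.uncurry f) (U ×ˢ S))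
    (hf' : ContinuousOn (Function.uncurry f') (U ×ˢ S))
    (hderiv : ∀ x ∈ U, ∀ y ∈ S, HasFDerivAt (fun x => f x y) (f' x y) x) {x₀ : H}
    (hx₀ : x₀ ∈ U) :
    HasFDerivAt (fun x => ∫ y in S, f x y ∂ν) (∫ y in S, f' x₀ y ∂ν) x₀ := by
  obtain ⟨C, hC⟩ := hS.exists_bound_of_continuousOn (hf'.section_right hx₀)
  have hbound : ∀ᶠ x in 𝓝 x₀, ∀ y ∈ S, ‖f' x y‖ ≤ C + 1 := by
    obtain ⟨v, hv, h⟩ := hS.mem_uniformity_of_prod hf' hx₀ (Metric.dist_mem_uniformity one_pos)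
    rw [hU.nhdsWithin_eq hx₀] at hv
    filter_upwards [hv] with x hx y hy
    have h1 : dist (f' x y) (f' x₀ y) < 1 := h x hx y hy
    have h2 := norm_le_norm_add_norm_sub' (f' x y) (f' x₀ y)
    rw [dist_eq_norm] at h1
    linarith [hC y hy]
  have : IsFiniteMeasure (ν.restrict S) := ⟨by simpa using hS.measure_lt_top⟩
  refine hasFDerivAt_integral_of_dominated_of_fderiv_le (bound := fun _ => C + 1)
    (F := f) (F' := f') (inter_mem (hU.mem_nhds hx₀) hbound) ?_ ?_ ?_ ?_ ?_ ?_
  · filter_upwards [hU.mem_nhds hx₀] with x hx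
    exact (hf.section_right hx).aestronglyMeasurable_of_isCompact hS hSm
  · exact (hf.section_right hx₀).integrableOn_compact' hS hSm
  · exact (hf'.section_right hx₀).aestronglyMeasurable_of_isCompact hS hSm
  · filter_upwards [ae_restrict_mem hSm] with y hy x hx
    exact hx.2 y hy
  · exact integrable_const _
  · filter_upwards [ae_restrict_mem hSm] with y hy x hx
    exact hderiv x hx.1 y hy

theorem hasDerivAt_setIntegral_of_isCompact {U : Set ℝ} (hU : IsOpen U) (hS : IsCompact S)
    (hSm : MeasurableSet S) {f f' : ℝ → Y → G}
    (hf : ContinuousOn (Function.uncurry f) (U ×ˢ S))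
    (hf' : ContinuousOn (Function.uncurry f') (U ×ˢ S))
    (hderiv : ∀ x ∈ U, ∀ y ∈ S, HasDerivAt (fun x => f x y) (f' x y) x) {x₀ : ℝ}
    (hx₀ : x₀ ∈ U) :
    HasDerivAt (fun x => ∫ y in S, f x y ∂ν) (∫ y in S, f' x₀ y ∂ν) x₀ := by
  set L : G →L[ℝ] (ℝ →L[ℝ] G) := ContinuousLinearMap.smulRightL ℝ ℝ G (ContinuousLinearMap.id ℝ ℝ)
  have h := (hasFDerivAt_setIntegral_of_isCompact (ν := ν) hU hS hSm hf
    (f' := fun x y => L (f' x y)) (L.continuous.comp_continuousOn hf')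
    (fun x hx y hy => (hderiv x hx y hy).hasFDerivAt) hx₀).hasDerivAt
  have hi : IntegrableOn (fun y => L (f' x₀ y)) S ν :=
    (L.continuous.comp_continuousOn (hf'.section_right hx₀)).integrableOn_compact' hS hSm
  rw [ContinuousLinearMap.integral_apply hi] at h
  simpa [L] using h

end ParametricIntegral

section SmoothParametricIntegral

variable {Y H : Type} [NormedAddCommGroup Y] [NormedSpace ℝ Y] [NormedAddCommGroup H]
  [NormedSpace ℝ H]

open scoped ContDiff

theorem contDiffAt_uncurry_fderiv_left {G : Type} [NormedAddCommGroup G] [NormedSpace ℝ G]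
    {f : H → Y → G} {x : H} {y : Y} (hf : ContDiffAt ℝ ∞ (Function.uncurry f) (x, y)) :
    ContDiffAt ℝ ∞ (Function.uncurry fun x y => fderiv ℝ (fun x' => f x' y) x) (x, y) := by
  refine ContDiffAt.fderiv (f := fun (p : H × Y) (x' : H) => f x' p.2) (g := Prod.fst)
    (n := ∞) (m := ∞) ?_ contDiffAt_fst (by simp)
  have : ContDiffAt ℝ ∞ (fun p : (H × Y) × H => (p.2, p.1.2)) ((x, y), x) := by fun_prop
  exact ContDiffAt.comp (g := Function.uncurry f) ((x, y), x) hf this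

variable [MeasurableSpace Y] [OpensMeasurableSpace Y] {ν : Measure Y}
  [IsFiniteMeasureOnCompacts ν] {S : Set Y} {U : Set H}

theorem hasFDerivAt_setIntegral_of_contDiffAt {G : Type} [NormedAddCommGroup G] [NormedSpace ℝ G]
    (hU : IsOpen U) (hS : IsCompact S)
    {f : H → Y → G}
    (hf : ∀ x ∈ U, ∀ y ∈ S, ContDiffAt ℝ ∞ (Function.uncurry f) (x, y)) {x₀ : H} (hx₀ : x₀ ∈ U) :
    HasFDerivAt (fun x => ∫ y in S, f x y ∂ν)
      (∫ y in S, fderiv ℝ (fun x => f x y) x₀ ∂ν) x₀ := by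
  refine hasFDerivAt_setIntegral_of_isCompact hU hS hS.measurableSet
    (f' := fun x y => fderiv ℝ (fun x' => f x' y) x) ?_ ?_ ?_ hx₀
  · rintro ⟨x, y⟩ ⟨hx, hy⟩
    exact (hf x hx y hy).continuousAt.continuousWithinAt
  · rintro ⟨x, y⟩ ⟨hx, hy⟩
    exact (contDiffAt_uncurry_fderiv_left (hf x hx y hy)).continuousAt.continuousWithinAt
  · intro x hx y hy
    have : DifferentiableAt ℝ (fun x => f x y) x :=
      ((hf x hx y hy).comp (f := fun x => (x, y)) x (by fun_prop)).differentiableAt (by simp)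
    exact this.hasFDerivAt

theorem contDiffOn_setIntegral (hU : IsOpen U) (hS : IsCompact S)
    (n : ℕ) {G : Type} [NormedAddCommGroup G] [NormedSpace ℝ G]
    {f : H → Y → G} (hf : ∀ x ∈ U, ∀ y ∈ S, ContDiffAt ℝ ∞ (Function.uncurry f) (x, y)) :
    ContDiffOn ℝ n (fun x => ∫ y in S, f x y ∂ν) U := by
  induction n generalizing G with
  | zero =>
    refine contDiffOn_zero.2 (continuousOn_setIntegral_of_isCompact hS hS.measurableSet ?_)
    rintro ⟨x, y⟩ ⟨hx, hy⟩
    exact (hf x hx y hy).continuousAt.continuousWithinAt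
  | succ n ih =>
    push_cast
    refine (contDiffOn_succ_iff_fderiv_of_isOpen hU).2 ⟨fun x hx =>
      (hasFDerivAt_setIntegral_of_contDiffAt hU hS hf
        hx).differentiableAt.differentiableWithinAt, by simp, ?_⟩
    exact (ih (f := fun x y => fderiv ℝ (fun x' => f x' y) x) fun x hx y hy =>
      contDiffAt_uncurry_fderiv_left (hf x hx y hy)).congr fun x hx =>
        (hasFDerivAt_setIntegral_of_contDiffAt hU hS hf hx).fderiv

end SmoothParametricIntegral

section Polar

variable {E : Type*} [NormedAddCommGroup E] [NormedSpace ℝ E] [MeasurableSpace E] [BorelSpace E]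
  [Nontrivial E] [FiniteDimensional ℝ E] (μ : Measure E) [μ.IsAddHaarMeasure]

theorem integral_volumeIoiPow (n : ℕ) (f : ℝ → ℝ) :
    ∫ r : Ioi (0 : ℝ), f r ∂(Measure.volumeIoiPow n) = ∫ r in Ioi (0 : ℝ), r ^ n * f r := by
  simp only [Measure.volumeIoiPow, ENNReal.ofReal]
  rw [integral_withDensity_eq_integral_smul,
    integral_subtype_comap measurableSet_Ioi fun a ↦ Real.toNNReal (a ^ n) • f a,
    setIntegral_congr_fun measurableSet_Ioi fun x hx ↦ ?_]
  · rw [NNReal.smul_def, Real.coe_toNNReal _ (pow_nonneg hx.out.le _), smul_eq_mul]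
  · exact (measurable_subtype_coe.pow_const _).real_toNNReal

theorem integral_eq_integral_sphere_prod (G : E → ℝ) :
    ∫ z, G z ∂μ = ∫ p : Metric.sphere (0 : E) 1 × Ioi (0 : ℝ), G ((p.2 : ℝ) • (p.1 : E))
      ∂(μ.toSphere.prod (.volumeIoiPow (Module.finrank ℝ E - 1))) := by
  calc
    ∫ z, G z ∂μ = ∫ z : ({(0)}ᶜ : Set E), G z.1 ∂(μ.comap (↑)) := by
      rw [integral_subtype_comap (measurableSet_singleton _).compl fun z ↦ G z,
        restrict_compl_singleton]
    _ = _ := by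
      rw [← μ.measurePreserving_homeomorphUnitSphereProd.integral_comp
        (Homeomorph.measurableEmbedding _)]
      refine integral_congr_ae (Eventually.of_forall fun z => ?_)
      have hz : ‖(z : E)‖ ≠ 0 := norm_ne_zero_iff.2 z.2
      simp [smul_smul, hz]

theorem integrable_sphere_prod {G : E → ℝ} (hG : Integrable G μ) :
    Integrable (fun p : Metric.sphere (0 : E) 1 × Ioi (0 : ℝ) => G ((p.2 : ℝ) • (p.1 : E)))
      (μ.toSphere.prod (.volumeIoiPow (Module.finrank ℝ E - 1))) := by
  rw [← μ.measurePreserving_homeomorphUnitSphereProd.integrable_comp_emb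
        (Homeomorph.measurableEmbedding _)]
  rw [← restrict_compl_singleton (μ := μ) 0, ← IntegrableOn,
    integrableOn_iff_comap_subtypeVal (measurableSet_singleton _).compl] at hG
  refine hG.congr (Eventually.of_forall fun z => ?_)
  have hz : ‖(z : E)‖ ≠ 0 := norm_ne_zero_iff.2 z.2
  simp [smul_smul, hz]

theorem integral_eq_integral_Ioi_sphere {G : E → ℝ} (hG : Integrable G μ) :
    ∫ z, G z ∂μ = ∫ r in Ioi (0 : ℝ), r ^ (Module.finrank ℝ E - 1) *
      ∫ ω : Metric.sphere (0 : E) 1, G (r • (ω : E)) ∂μ.toSphere := by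
  rw [integral_eq_integral_sphere_prod, integral_prod_symm _ (integrable_sphere_prod μ hG)]
  exact integral_volumeIoiPow _ fun r => ∫ ω : Metric.sphere (0 : E) 1, G (r • (ω : E)) ∂μ.toSphere

theorem setIntegral_ball_eq_intervalIntegral_sphere {G : E → ℝ} {R : ℝ} (hR : 0 ≤ R)
    (hG : IntegrableOn G (Metric.ball 0 R) μ) :
    ∫ z in Metric.ball 0 R, G z ∂μ = ∫ r in (0 : ℝ)..R, r ^ (Module.finrank ℝ E - 1) *
      ∫ ω : Metric.sphere (0 : E) 1, G (r • (ω : E)) ∂μ.toSphere := by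
  rw [← integral_indicator Metric.isOpen_ball.measurableSet, integral_eq_integral_Ioi_sphere μ
    ((integrable_indicator_iff Metric.isOpen_ball.measurableSet).2 hG),
    intervalIntegral.integral_of_le hR, ← integral_Ioc_eq_integral_Ioo.symm,
    ← Ioi_inter_Iio, ← setIntegral_indicator measurableSet_Iio]
  refine setIntegral_congr_fun measurableSet_Ioi fun r hr => ?_
  have hr' : (0 : ℝ) < r := hr
  have hn : ∀ ω : Metric.sphere (0 : E) 1, ‖r • (ω : E)‖ = r := fun ω => by
    simp [norm_smul, abs_of_pos hr']
  by_cases h : r < R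
  · simp only [mem_Iio, h, indicator_of_mem]
    congr 1
    refine integral_congr_ae (Eventually.of_forall fun ω => ?_)
    simp [indicator, hn, h]
  · simp only [mem_Iio, h, not_false_eq_true, indicator_of_notMem]
    rw [mul_eq_zero]
    right
    refine integral_eq_zero_of_ae (Eventually.of_forall fun ω => ?_)
    simp [indicator, hn, h]

end Polar

theorem eq_zero_of_integral_sq_sub_sq_mul_eq_zero {h : ℝ → ℝ} (hh : ContinuousOn h (Icc 0 1))
    (hint : ∀ R ∈ Ioo (0 : ℝ) 1, ∫ r in (0 : ℝ)..R, (R ^ 2 - r ^ 2) * h r = 0) : h 1 = 0 := by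
  set k : ℝ → ℝ := IccExtend zero_le_one ((Icc (0 : ℝ) 1).domRestrict h) with hk
  have hkc : Continuous k := (continuousOn_iff_continuous_domRestrict.1 hh).Icc_extend'
  have hkh : ∀ r ∈ Icc (0 : ℝ) 1, k r = h r := fun r hr =>
    IccExtend_of_mem _ _ hr
  have hk0 : ∀ R ∈ Ioo (0 : ℝ) 1,
      R ^ 2 * (∫ r in (0 : ℝ)..R, k r) - ∫ r in (0 : ℝ)..R, r ^ 2 * k r = 0 := by
    intro R hR
    refine Eq.trans ?_ (hint R hR)
    rw [← intervalIntegral.integral_const_mul, ← intervalIntegral.integral_sub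
      (Continuous.intervalIntegrable (by fun_prop) _ _)
      (Continuous.intervalIntegrable (by fun_prop) _ _)]
    refine intervalIntegral.integral_congr fun r hr => ?_
    rw [uIcc_of_le hR.1.le] at hr
    simp only [hkh r ⟨hr.1, hr.2.trans hR.2.le⟩]
    ring
  have hd1 : ∀ R, HasDerivAt (fun R => ∫ r in (0 : ℝ)..R, k r) (k R) R := fun R =>
    hkc.integral_hasStrictDerivAt 0 R |>.hasDerivAt
  have hd2 : ∀ R, HasDerivAt (fun R => ∫ r in (0 : ℝ)..R, r ^ 2 * k r) (R ^ 2 * k R) R := fun R =>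
    (Continuous.integral_hasStrictDerivAt (f := fun r => r ^ 2 * k r)
      (by fun_prop) 0 R).hasDerivAt
  have hI : ∀ R ∈ Ioo (0 : ℝ) 1, ∫ r in (0 : ℝ)..R, k r = 0 := by
    intro R hR
    have h1 := ((hasDerivAt_pow 2 R).mul (hd1 R)).sub (hd2 R)
    have h2 := h1.unique (HasDerivAt.congr_of_eventuallyEq (hasDerivAt_const R (0 : ℝ))
      (by filter_upwards [isOpen_Ioo.mem_nhds hR] with x hx using hk0 x hx))
    have h3 : 2 * R * ∫ r in (0 : ℝ)..R, k r = 0 := by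
      push_cast at h2
      linear_combination h2
    have h4 : 2 * R ≠ 0 := by linarith [hR.1] |> fun h : 0 < 2 * R => h.ne'
    exact (mul_eq_zero.1 h3).resolve_left h4
  have hk1 : ∀ R ∈ Ioo (0 : ℝ) 1, k R = 0 := fun R hR =>
    (hd1 R).unique (HasDerivAt.congr_of_eventuallyEq (hasDerivAt_const R (0 : ℝ))
      (by filter_upwards [isOpen_Ioo.mem_nhds hR] with x hx using hI x hx))
  rw [← hkh 1 (by simp)]
  have : (1 : ℝ) ∈ closure (Ioo (0 : ℝ) 1) := by simp [closure_Ioo]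
  exact (isClosed_eq hkc continuous_const).closure_subset_iff.2 hk1 this

theorem hasDerivAt_max_zero_sq (x : ℝ) :
    HasDerivAt (fun t : ℝ => max t 0 ^ 2) (2 * max x 0) x := by
  rcases lt_trichotomy x 0 with h | rfl | h
  · rw [max_eq_right h.le, mul_zero]
    refine (hasDerivAt_const x (0 : ℝ)).congr_of_eventuallyEq ?_
    filter_upwards [gt_mem_nhds h] with t ht
    simp [max_eq_right ht.le]
  · rw [hasDerivAt_iff_isLittleO_nhds_zero]
    simp only [zero_add, max_self, mul_zero, smul_zero, sub_zero, ne_eq, OfNat.ofNat_ne_zero,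
      not_false_eq_true, zero_pow]
    refine Asymptotics.IsBigO.trans_isLittleO (g := fun t : ℝ => t ^ 2) ?_ ?_
    · refine Asymptotics.IsBigO.of_bound 1 (Eventually.of_forall fun t => ?_)
      rw [Real.norm_of_nonneg (by positivity), Real.norm_of_nonneg (by positivity), one_mul,
        ← sq_abs t]
      gcongr
      exact max_le (le_abs_self t) (abs_nonneg t)
    · simpa using Asymptotics.isLittleO_pow_id (𝕜 := ℝ) one_lt_two
  · rw [max_eq_left h.le]
    have := (hasDerivAt_pow 2 x)
    norm_num at this
    refine this.congr_of_eventuallyEq ?_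
    filter_upwards [lt_mem_nhds h] with t ht
    simp [max_eq_left ht.le]

section Divergence

variable {N : ℕ}

local notation "𝔼" => EuclideanSpace ℝ (Fin N)

theorem hasFDerivAt_max_sq_sub_norm_sq (R : ℝ) (z : 𝔼) :
    HasFDerivAt (fun z : 𝔼 => max (R ^ 2 - ‖z‖ ^ 2) 0 ^ 2)
      ((2 * max (R ^ 2 - ‖z‖ ^ 2) 0) • (-((2 : ℝ) • innerSL ℝ z) : 𝔼 →L[ℝ] ℝ)) z := by
  refine (hasDerivAt_max_zero_sq _).comp_hasFDerivAt (f := fun z : 𝔼 => R ^ 2 - ‖z‖ ^ 2) z ?_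
  have := (hasStrictFDerivAt_norm_sq z).hasFDerivAt.const_sub (R ^ 2)
  rwa [← Nat.cast_smul_eq_nsmul ℝ] at this

theorem setIntegral_ball_radial_eq_zero {F : Fin N → 𝔼 → ℝ}
    (hF : ∀ j, ∀ z ∈ Metric.closedBall (0 : 𝔼) 1, ContDiffAt ℝ 1 (F j) z)
    (hdiv : ∀ z ∈ Metric.closedBall (0 : 𝔼) 1,
      ∑ j, fderiv ℝ (F j) z (EuclideanSpace.single j 1) = 0) {R : ℝ} (hR : R ∈ Ioo (0 : ℝ) 1) :
    ∫ z in Metric.ball (0 : 𝔼) R, (R ^ 2 - ‖z‖ ^ 2) * ∑ j, z j * F j z = 0 := by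
  set θ : 𝔼 → ℝ := fun z => max (R ^ 2 - ‖z‖ ^ 2) 0 ^ 2 with hθ
  have hzero : ∀ z ∉ Metric.closedBall (0 : 𝔼) R, max (R ^ 2 - ‖z‖ ^ 2) 0 = 0 := by
    intro z hz
    have : R < ‖z‖ := by simpa using hz
    refine max_eq_right ?_
    nlinarith [hR.1]
  have hsub : Metric.closedBall (0 : 𝔼) R ⊆ Metric.closedBall 0 1 :=
    Metric.closedBall_subset_closedBall hR.2.le
  have hθs : tsupport θ ⊆ Metric.closedBall 0 R := by
    refine closure_minimal (fun z hz => ?_) Metric.isClosed_closedBall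
    by_contra h
    exact hz (by simp [hθ, hzero z h])
  have hint : ∀ f : 𝔼 → ℝ, ContinuousOn f (Metric.closedBall 0 R) →
      (∀ z ∉ Metric.closedBall (0 : 𝔼) R, f z = 0) → Integrable f := by
    intro f hf hf0
    refine (integrableOn_iff_integrable_of_support_subset (s := Metric.closedBall 0 R)
      fun z hz => ?_).1 (hf.integrableOn_compact (isCompact_closedBall _ _))
    by_contra h
    exact hz (hf0 z h)
  have hθd : ∀ j z, fderiv ℝ θ z (EuclideanSpace.single j 1) =
      -4 * (max (R ^ 2 - ‖z‖ ^ 2) 0 * z j) := by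
    intro j z
    rw [(hasFDerivAt_max_sq_sub_norm_sq R z).fderiv]
    have : inner ℝ z (EuclideanSpace.single j (1 : ℝ)) = z j := by
      simp [EuclideanSpace.inner_single_right]
    simp [this]
    ring
  have hFc : ∀ j, ContinuousOn (F j) (Metric.closedBall 0 R) := fun j z hz =>
    (hF j z (hsub hz)).continuousAt.continuousWithinAt
  have hF'c : ∀ j, ContinuousOn (fun z => fderiv ℝ (F j) z (EuclideanSpace.single j 1))
      (Metric.closedBall 0 R) := fun j z hz =>
    (((hF j z (hsub hz)).fderiv_right (m := 0) (by simp)).continuousAt.clm_apply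
      continuousAt_const).continuousWithinAt
  have hi1 : ∀ j, Integrable fun z => max (R ^ 2 - ‖z‖ ^ 2) 0 * (z j * F j z) := by
    intro j
    refine hint _ ?_ fun z hz => by simp [hzero z hz]
    have := hFc j
    fun_prop
  have hi2 : ∀ j, Integrable fun z => θ z * fderiv ℝ (F j) z (EuclideanSpace.single j 1) := by
    intro j
    refine hint _ ?_ fun z hz => by simp [hθ, hzero z hz]
    have := hF'c j
    fun_prop
  have key : ∀ j, ∫ z, θ z * fderiv ℝ (F j) z (EuclideanSpace.single j 1) =
      4 * ∫ z, max (R ^ 2 - ‖z‖ ^ 2) 0 * (z j * F j z) := by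
    intro j
    rw [integral_mul_fderiv_eq_neg_fderiv_mul_of_integrable _ (hi2 j)]
    · rw [← integral_neg, ← integral_const_mul]
      refine integral_congr_ae (Eventually.of_forall fun z => ?_)
      simp only [hθd]
      ring
    · refine hint _ ?_ fun z hz => by simp [hθ, hzero z hz]
      have := hFc j
      fun_prop
    · exact fun z _ => (hasFDerivAt_max_sq_sub_norm_sq R z).differentiableAt
    · exact fun z hz => (hF j z (hsub (hθs hz))).differentiableAt (by simp)
    · simp only [hθd]
      convert (hi1 j).const_mul (-4) using 2
      ring
  have hsum : ∑ j, ∫ z, θ z * fderiv ℝ (F j) z (EuclideanSpace.single j 1) = 0 := by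
    rw [← integral_finsetSum _ fun j _ => hi2 j]
    refine integral_eq_zero_of_ae (Eventually.of_forall fun z => ?_)
    simp only [← Finset.mul_sum, Pi.zero_apply]
    by_cases hz : z ∈ Metric.closedBall (0 : 𝔼) R
    · rw [hdiv z (hsub hz), mul_zero]
    · simp [hθ, hzero z hz]
  simp only [key] at hsum
  rw [← Finset.mul_sum, ← integral_finsetSum _ fun j _ => hi1 j] at hsum
  rw [← integral_indicator Metric.isOpen_ball.measurableSet]
  refine Eq.trans (integral_congr_ae (Eventually.of_forall fun z => ?_))
    ((mul_eq_zero.1 hsum).resolve_left (by norm_num))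
  simp only [← Finset.mul_sum]
  by_cases hz : z ∈ Metric.ball (0 : 𝔼) R
  · have : ‖z‖ < R := by simpa using hz
    rw [indicator_of_mem hz, max_eq_left]
    nlinarith [norm_nonneg z]
  · have : R ≤ ‖z‖ := by simpa using hz
    rw [indicator_of_notMem hz, max_eq_right, zero_mul]
    nlinarith [hR.1]

/-- Divergence theorem on the unit ball, for a divergence-free vector field. -/
theorem integral_sphere_sum_mul_eq_zero (hN : 0 < N) {F : Fin N → 𝔼 → ℝ}
    (hF : ∀ j, ∀ z ∈ Metric.closedBall (0 : 𝔼) 1, ContDiffAt ℝ 1 (F j) z)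
    (hdiv : ∀ z ∈ Metric.closedBall (0 : 𝔼) 1,
      ∑ j, fderiv ℝ (F j) z (EuclideanSpace.single j 1) = 0) :
    ∫ ω : Metric.sphere (0 : 𝔼) 1, ∑ j, (ω : 𝔼) j * F j ω
      ∂(volume : Measure 𝔼).toSphere = 0 := by
  have : Nonempty (Fin N) := ⟨⟨0, hN⟩⟩
  have hmem : ∀ r ∈ Icc (0 : ℝ) 1, ∀ ω : Metric.sphere (0 : 𝔼) 1,
      r • (ω : 𝔼) ∈ Metric.closedBall (0 : 𝔼) 1 := by
    intro r hr ω
    simpa [norm_smul, abs_of_nonneg hr.1] using hr.2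
  have hFc : ∀ j, ContinuousOn (F j) (Metric.closedBall 0 1) := fun j z hz =>
    (hF j z hz).continuousAt.continuousWithinAt
  set Φ : ℝ → ℝ := fun r => ∫ ω : Metric.sphere (0 : 𝔼) 1, ∑ j, (ω : 𝔼) j * F j (r • (ω : 𝔼))
      ∂(volume : Measure 𝔼).toSphere with hΦ
  have hΦc : ContinuousOn Φ (Icc 0 1) := by
    have := continuousOn_setIntegral_of_isCompact (Y := Metric.sphere (0 : 𝔼) 1)
      (ν := (volume : Measure 𝔼).toSphere) (U := Icc (0 : ℝ) 1) isCompact_univ MeasurableSet.univ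
      (f := fun r ω => ∑ j, (ω : 𝔼) j * F j (r • (ω : 𝔼))) ?_
    · simpa [hΦ] using this
    · refine continuousOn_finsetSum _ fun j _ => ContinuousOn.mul (by fun_prop) ?_
      refine (hFc j).comp (f := fun p : ℝ × Metric.sphere (0 : 𝔼) 1 => p.1 • (p.2 : 𝔼))
        (by fun_prop) ?_
      rintro ⟨r, ω⟩ ⟨hr, -⟩
      exact hmem r hr ω
  have h1 := eq_zero_of_integral_sq_sub_sq_mul_eq_zero (h := fun r : ℝ => r ^ N * Φ r)
    ((continuousOn_pow N).mul hΦc) fun R hR => ?_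
  · simpa [hΦ] using h1
  · have h2 := setIntegral_ball_radial_eq_zero hF hdiv hR
    rw [setIntegral_ball_eq_intervalIntegral_sphere (volume : Measure 𝔼) hR.1.le] at h2
    · refine Eq.trans ?_ h2
      refine intervalIntegral.integral_congr fun r hr => ?_
      rw [uIcc_of_le hR.1.le] at hr
      have hn : ∀ ω : Metric.sphere (0 : 𝔼) 1, ‖r • (ω : 𝔼)‖ = r := fun ω => by
        simp [norm_smul, abs_of_nonneg hr.1]
      simp only [hΦ, hn, ← integral_const_mul, finrank_euclideanSpace_fin]
      refine integral_congr_ae (Eventually.of_forall fun ω => ?_)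
      simp only [PiLp.smul_apply, smul_eq_mul, mul_assoc, ← Finset.mul_sum]
      obtain ⟨n, rfl⟩ : ∃ n, N = n + 1 := ⟨N - 1, by omega⟩
      simp
      ring
    · refine IntegrableOn.mono_set ?_ Metric.ball_subset_closedBall
      refine ContinuousOn.integrableOn_compact (isCompact_closedBall _ _) ?_
      have : ∀ j, ContinuousOn (F j) (Metric.closedBall 0 R) := fun j =>
        (hFc j).mono (Metric.closedBall_subset_closedBall hR.2.le)
      fun_prop

end Divergence

section Shell

variable {N : ℕ}

local notation "𝔼" => EuclideanSpace ℝ (Fin N)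

/-- The squared distance from `x` to the image of `z` under the diagonal map with entries `c`. -/
noncomputable def diagSqDist (c x : Fin N → ℝ) (z : 𝔼) : ℝ := ∑ j, (x j - c j * z j) ^ 2

/-- The Newtonian potential at `x` of the image of the uniform measure of the unit sphere under the
diagonal map with entries `c`. -/
noncomputable def shellPotential (c x : Fin N → ℝ) : ℝ :=
  ∫ ω : Metric.sphere (0 : 𝔼) 1, diagSqDist c x ω ^ (1 - N / 2 : ℝ) ∂(volume : Measure 𝔼).toSphere

theorem diagSqDist_nonneg (c x : Fin N → ℝ) (z : 𝔼) : 0 ≤ diagSqDist c x z :=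
  Finset.sum_nonneg fun _ _ => sq_nonneg _

theorem diagSqDist_ne_zero_iff {c x : Fin N → ℝ} {z : 𝔼} :
    diagSqDist c x z ≠ 0 ↔ ∃ j, x j ≠ c j * z j := by
  rw [diagSqDist, Ne, Finset.sum_eq_zero_iff_of_nonneg fun _ _ => sq_nonneg _]
  simp [sub_eq_zero]

theorem contDiff_diagSqDist (c x : Fin N → ℝ) : ContDiff ℝ ⊤ (diagSqDist c x) := by
  unfold diagSqDist
  fun_prop

theorem hasFDerivAt_diagSqDist (c x : Fin N → ℝ) (z : 𝔼) :
    HasFDerivAt (diagSqDist c x)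
      (∑ j, (2 * (x j - c j * z j)) • -(c j • (EuclideanSpace.proj j : 𝔼 →L[ℝ] ℝ))) z := by
  unfold diagSqDist
  refine HasFDerivAt.fun_sum fun j _ => ?_
  have h : HasFDerivAt (fun z : 𝔼 => z j) (EuclideanSpace.proj j : 𝔼 →L[ℝ] ℝ) z :=
    (EuclideanSpace.proj j : 𝔼 →L[ℝ] ℝ).hasFDerivAt
  have := ((h.const_mul (c j)).const_sub (x j)).pow 2
  simpa using this

theorem sum_fderiv_shellField (c x : Fin N → ℝ) (hc : ∀ j, c j ≠ 0) {z : 𝔼}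
    (hz : diagSqDist c x z ≠ 0) :
    ∑ j, fderiv ℝ (fun z => (c j)⁻¹ * (x j - c j * z j) * diagSqDist c x z ^ (-(N / 2) : ℝ)) z
      (EuclideanSpace.single j 1) = 0 := by
  have hpos : 0 < diagSqDist c x z := (diagSqDist_nonneg c x z).lt_of_ne' hz
  have key : ∀ j, fderiv ℝ (fun z => (c j)⁻¹ * (x j - c j * z j) *
      diagSqDist c x z ^ (-(N / 2) : ℝ)) z (EuclideanSpace.single j 1) =
      -diagSqDist c x z ^ (-(N / 2) : ℝ) +
        N * diagSqDist c x z ^ (-(N / 2) - 1 : ℝ) * (x j - c j * z j) ^ 2 := by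
    intro j
    have h : HasFDerivAt (fun z : 𝔼 => z j) (EuclideanSpace.proj j : 𝔼 →L[ℝ] ℝ) z :=
      (EuclideanSpace.proj j : 𝔼 →L[ℝ] ℝ).hasFDerivAt
    have h1 := (((h.const_mul (c j)).const_sub (x j)).const_mul (c j)⁻¹).fun_mul
      ((hasFDerivAt_diagSqDist c x z).rpow_const (p := (-(N / 2) : ℝ)) (Or.inl hz))
    rw [HasFDerivAt.fderiv h1]
    have hcj := hc j
    simp
    field_simp
    ring
  simp only [key, Finset.sum_add_distrib, ← Finset.mul_sum]
  simp only [Finset.sum_const, Finset.card_univ, Fintype.card_fin, nsmul_eq_mul]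
  rw [← diagSqDist, mul_assoc, ← Real.rpow_add_one hz]
  ring_nf

theorem integral_sphere_shellField (hN : 0 < N) (c x : Fin N → ℝ) (hc : ∀ j, c j ≠ 0)
    (hx : ∀ z ∈ Metric.closedBall (0 : 𝔼) 1, diagSqDist c x z ≠ 0) :
    ∫ ω : Metric.sphere (0 : 𝔼) 1, ∑ j, (ω : 𝔼) j * ((c j)⁻¹ * (x j - c j * (ω : 𝔼) j) *
      diagSqDist c x ω ^ (-(N / 2) : ℝ)) ∂(volume : Measure 𝔼).toSphere = 0 := by
  refine integral_sphere_sum_mul_eq_zero hN (F := fun j z => (c j)⁻¹ * (x j - c j * z j) *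
      diagSqDist c x z ^ (-(N / 2) : ℝ)) (fun j z hz => ?_) fun z hz =>
    sum_fderiv_shellField c x hc (hx z hz)
  refine ContDiffAt.mul (by fun_prop) (ContDiffAt.rpow_const_of_ne ?_ (hx z hz))
  exact (contDiff_diagSqDist c x).contDiffAt.of_le le_top

theorem hasDerivAt_diagSqDist_sqrt {b x : Fin N → ℝ} {s : ℝ} (hs : ∀ j, 0 < b j + s) (z : 𝔼) :
    HasDerivAt (fun s => diagSqDist (fun j => √(b j + s)) x z)
      (-∑ j, z j * ((√(b j + s))⁻¹ * (x j - √(b j + s) * z j))) s := by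
  unfold diagSqDist
  rw [← Finset.sum_neg_distrib]
  refine HasDerivAt.fun_sum fun j _ => ?_
  have h1 := ((((hasDerivAt_id s).const_add (b j)).sqrt (hs j).ne').mul_const (z j)).const_sub (x j)
  refine (h1.fun_pow 2).congr_deriv ?_
  have : √(b j + s) ≠ 0 := (Real.sqrt_pos.2 (hs j)).ne'
  simp only [id]
  field_simp
  norm_num
  ring

theorem continuousOn_shellPotential {b x : Fin N → ℝ} {I : Set ℝ}
    (hx : ∀ s ∈ I, ∀ z ∈ Metric.sphere (0 : 𝔼) 1, diagSqDist (fun j => √(b j + s)) x z ≠ 0) :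
    ContinuousOn (fun s => shellPotential (fun j => √(b j + s)) x) I := by
  have := continuousOn_setIntegral_of_isCompact (Y := Metric.sphere (0 : 𝔼) 1)
      (ν := (volume : Measure 𝔼).toSphere) (U := I) isCompact_univ MeasurableSet.univ
      (f := fun s ω => diagSqDist (fun j => √(b j + s)) x ω ^ (1 - N / 2 : ℝ)) ?_
  · simpa [shellPotential] using this
  · refine ContinuousOn.rpow_const ?_ fun p hp => Or.inl (hx p.1 hp.1 p.2 p.2.2)
    unfold diagSqDist
    fun_prop

theorem hasDerivAt_shellPotential (hN : 0 < N) {b x : Fin N → ℝ} (hb : ∀ j, 0 ≤ b j) {T : ℝ}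
    (hx : ∀ s ∈ Ioo 0 T, ∀ z ∈ Metric.closedBall (0 : 𝔼) 1,
      diagSqDist (fun j => √(b j + s)) x z ≠ 0) {s : ℝ} (hs : s ∈ Ioo 0 T) :
    HasDerivAt (fun s => shellPotential (fun j => √(b j + s)) x) 0 s := by
  have hpos : ∀ s ∈ Ioo 0 T, ∀ j, 0 < b j + s := fun s hs j => by linarith [hb j, hs.1]
  set f' : ℝ → Metric.sphere (0 : 𝔼) 1 → ℝ := fun s ω =>
    -(∑ j, (ω : 𝔼) j * ((√(b j + s))⁻¹ * (x j - √(b j + s) * (ω : 𝔼) j))) *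
      (1 - N / 2 : ℝ) * diagSqDist (fun j => √(b j + s)) x ω ^ ((1 - N / 2 : ℝ) - 1) with hf'
  have hc : ContinuousOn (fun p : ℝ × Metric.sphere (0 : 𝔼) 1 =>
      diagSqDist (fun j => √(b j + p.1)) x p.2) (Ioo 0 T ×ˢ univ) := by
    unfold diagSqDist
    fun_prop
  have hne : ∀ p ∈ Ioo 0 T ×ˢ (univ : Set (Metric.sphere (0 : 𝔼) 1)),
      diagSqDist (fun j => √(b j + p.1)) x p.2 ≠ 0 := fun p hp =>
    hx p.1 hp.1 p.2 (Metric.sphere_subset_closedBall p.2.2)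
  have h := hasDerivAt_setIntegral_of_isCompact (Y := Metric.sphere (0 : 𝔼) 1)
      (ν := (volume : Measure 𝔼).toSphere) (U := Ioo 0 T) isOpen_Ioo isCompact_univ
      MeasurableSet.univ
      (f := fun s ω => diagSqDist (fun j => √(b j + s)) x ω ^ (1 - N / 2 : ℝ))
      (f' := f') ?_ ?_ ?_ hs
  · simp only [Measure.restrict_univ] at h
    have h1 := integral_sphere_shellField hN (fun j => √(b j + s)) x
      (fun j => (Real.sqrt_pos.2 (hpos s hs j)).ne') (hx s hs)
    have h2 := congrArg (fun t => -(1 - N / 2 : ℝ) * t) h1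
    simp only [mul_zero] at h2
    rw [← integral_const_mul] at h2
    suffices h0 : ∫ ω, f' s ω ∂(volume : Measure 𝔼).toSphere = 0 by rwa [h0] at h
    refine Eq.trans ?_ h2
    refine integral_congr_ae (Eventually.of_forall fun ω => ?_)
    simp only [← mul_assoc, ← Finset.sum_mul, hf']
    rw [show (1 - N / 2 : ℝ) - 1 = -(N / 2) by ring]
    ring
  · exact hc.rpow_const fun p hp => Or.inl (hne p hp)
  · refine ContinuousOn.mul (ContinuousOn.mul (ContinuousOn.neg ?_) continuousOn_const)
      (hc.rpow_const fun p hp => Or.inl (hne p hp))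
    refine continuousOn_finsetSum _ fun j _ => ContinuousOn.mul (by fun_prop)
      (ContinuousOn.mul (ContinuousOn.inv₀ (by fun_prop) fun p hp => ?_) (by fun_prop))
    exact (Real.sqrt_pos.2 (hpos p.1 hp.1 j)).ne'
  · intro s hs ω _
    exact (hasDerivAt_diagSqDist_sqrt (hpos s hs) (ω : 𝔼)).rpow_const
      (Or.inl (hx s hs ω (Metric.sphere_subset_closedBall ω.2)))

theorem shellPotential_sqrt_add_eq (hN : 0 < N) {b x : Fin N → ℝ} (hb : ∀ j, 0 ≤ b j) {T : ℝ}
    (hx : ∀ s ∈ Ico 0 T, ∀ z ∈ Metric.closedBall (0 : 𝔼) 1,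
      diagSqDist (fun j => √(b j + s)) x z ≠ 0) {s : ℝ} (hs : s ∈ Ico 0 T) :
    shellPotential (fun j => √(b j + s)) x = shellPotential (fun j => √(b j)) x := by
  rcases hs.1.eq_or_lt with rfl | h0
  · simp
  obtain ⟨r, -, h⟩ := exists_hasDerivAt_eq_slope
    (fun s => shellPotential (fun j => √(b j + s)) x) (fun _ => 0) h0
    (continuousOn_shellPotential fun r hr z hz => hx r ⟨hr.1, hr.2.trans_lt hs.2⟩ z
      (Metric.sphere_subset_closedBall hz)) fun r hr => hasDerivAt_shellPotential hN hb
        (fun r hr => hx r ⟨hr.1.le, hr.2⟩) ⟨hr.1, hr.2.trans hs.2⟩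
  have : s - 0 ≠ 0 := by linarith |> fun h : 0 < s - 0 => h.ne'
  field_simp at h
  simp at h
  linarith

end Shell

section MeanValue

variable {E : Type*} [NormedAddCommGroup E] [InnerProductSpace ℝ E] [FiniteDimensional ℝ E]
  [MeasurableSpace E] [BorelSpace E]

theorem eq_zero_of_integral_sphere_eq_zero (μ : Measure E) [μ.IsAddHaarMeasure]
    {f : Metric.sphere (0 : E) 1 → ℝ} (hf : Continuous f) (h0 : ∀ ω, 0 ≤ f ω)
    (h : ∫ ω, f ω ∂μ.toSphere = 0) : f = 0 := by
  have hi : Integrable f μ.toSphere := by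
    have := hf.continuousOn.integrableOn_compact (μ := μ.toSphere) isCompact_univ
    simpa using this
  exact (Continuous.ae_eq_iff_eq _ hf continuous_const).1
    ((integral_eq_zero_iff_of_nonneg h0 hi).1 h)

theorem le_map_zero_of_mean_value (μ : Measure E) [μ.IsAddHaarMeasure]
    {K : Set E} (hK : IsCompact K) (h0 : (0 : E) ∈ K) {g : E → ℝ} (hg : ContinuousOn g K)
    (hbd : ∀ p ∈ K, p ∉ interior K → ∃ p' ∈ K, g p' = g p ∧ ‖p'‖ < ‖p‖)
    (hmv : ∀ p, ∀ r > 0, Metric.closedBall p (2 * r) ⊆ K →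
      ∫ ω : Metric.sphere (0 : E) 1, g (p + r • (ω : E)) ∂μ.toSphere =
        μ.toSphere.real univ * g p) {p : E} (hp : p ∈ K) : g p ≤ g 0 := by
  obtain ⟨m, hm, hmax⟩ := hK.exists_isMaxOn ⟨0, h0⟩ hg
  have hK' : IsCompact (K ∩ g ⁻¹' {g m}) :=
    hK.of_isClosed_subset (hg.preimage_isClosed_of_isClosed hK.isClosed isClosed_singleton)
      inter_subset_left
  obtain ⟨q, ⟨hqK, hqm⟩, hq⟩ := hK'.exists_isMinOn ⟨m, hm, rfl⟩ continuous_norm.continuousOn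
  have hqm : g q = g m := hqm
  have hclosest : ∀ p' ∈ K, g p' = g q → ‖q‖ ≤ ‖p'‖ := fun p' hp' h => hq ⟨hp', h.trans hqm⟩
  suffices q = 0 by
    rw [← this, hqm]
    exact hmax hp
  by_contra hq0
  have hqpos : 0 < ‖q‖ := norm_pos_iff.2 hq0
  by_cases hint : q ∈ interior K
  · obtain ⟨ε, hε, hball⟩ := Metric.isOpen_iff.1 isOpen_interior q hint
    set r := min (ε / 4) (‖q‖ / 2) with hr
    have hr0 : 0 < r := by positivity
    have hr1 : r ≤ ε / 4 := min_le_left _ _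
    have hr2 : r ≤ ‖q‖ / 2 := min_le_right _ _
    have hsub : Metric.closedBall q (2 * r) ⊆ K :=
      (Metric.closedBall_subset_ball (by linarith)).trans (hball.trans interior_subset)
    have hmem : ∀ ω : Metric.sphere (0 : E) 1, q + r • (ω : E) ∈ K := fun ω => hsub <| by
      rw [Metric.mem_closedBall, dist_eq_norm, add_sub_cancel_left, norm_smul,
        norm_eq_of_mem_sphere, Real.norm_of_nonneg hr0.le]
      linarith
    have hcont : Continuous fun ω : Metric.sphere (0 : E) 1 => g (q + r • (ω : E)) :=
      hg.comp_continuous (by fun_prop) hmem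
    have hzero := eq_zero_of_integral_sphere_eq_zero μ
      (f := fun ω => g q - g (q + r • (ω : E))) (continuous_const.sub hcont)
      (fun ω => sub_nonneg.2 (hqm ▸ hmax (hmem ω))) <| by
        have hi : Integrable (fun ω : Metric.sphere (0 : E) 1 => g (q + r • (ω : E)))
            μ.toSphere := by
          simpa using hcont.continuousOn.integrableOn_compact (μ := μ.toSphere) isCompact_univ
        rw [integral_sub (integrable_const _) hi, hmv q r hr0 hsub, integral_const, smul_eq_mul,
          sub_self]
    let ω : Metric.sphere (0 : E) 1 := ⟨-(‖q‖⁻¹ • q), by simp [norm_smul, hqpos.ne']⟩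
    have hω := congrFun hzero ω
    have h1 := hclosest _ (hmem ω) (sub_eq_zero.1 hω).symm
    have h2 : q + r • (ω : E) = (1 - r * ‖q‖⁻¹) • q := by
      simp only [ω, smul_neg, smul_smul, sub_smul, one_smul]
      abel
    have h3 : r * ‖q‖⁻¹ ≤ 1 / 2 := by
      rw [← div_eq_mul_inv, div_le_iff₀ hqpos]
      linarith
    rw [h2, norm_smul, Real.norm_of_nonneg (by linarith), sub_mul, one_mul, mul_assoc,
      inv_mul_cancel₀ hqpos.ne'] at h1
    linarith
  · obtain ⟨p', hp', h1, h2⟩ := hbd q hqK hint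
    exact h2.not_ge (hclosest p' hp' h1)

theorem eq_map_zero_of_mean_value (μ : Measure E) [μ.IsAddHaarMeasure]
    {K : Set E} (hK : IsCompact K) (h0 : (0 : E) ∈ K) {g : E → ℝ} (hg : ContinuousOn g K)
    (hbd : ∀ p ∈ K, p ∉ interior K → ∃ p' ∈ K, g p' = g p ∧ ‖p'‖ < ‖p‖)
    (hmv : ∀ p, ∀ r > 0, Metric.closedBall p (2 * r) ⊆ K →
      ∫ ω : Metric.sphere (0 : E) 1, g (p + r • (ω : E)) ∂μ.toSphere =
        μ.toSphere.real univ * g p) {p : E} (hp : p ∈ K) : g p = g 0 := by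
  refine (le_map_zero_of_mean_value μ hK h0 hg hbd hmv hp).antisymm ?_
  have := le_map_zero_of_mean_value μ hK h0 (g := fun p => -g p) hg.neg
    (fun p hp hi => by simpa using hbd p hp hi) (fun p r hr h => by
      rw [integral_neg, hmv p r hr h, mul_neg]) hp
  linarith

end MeanValue

section Confocal

variable {N : ℕ}

local notation "𝔼" => EuclideanSpace ℝ (Fin N)

theorem diagSqDist_sqrt_swap {b : Fin N → ℝ} {s t : ℝ} (hs : ∀ j, 0 ≤ b j + s)
    (ht : ∀ j, 0 ≤ b j + t) {ω η : 𝔼} (h : ‖ω‖ = ‖η‖) :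
    diagSqDist (fun j => √(b j + s)) (fun j => √(b j + t) * ω j) η =
      diagSqDist (fun j => √(b j + t)) (fun j => √(b j + s) * ω j) η := by
  have h2 : ∑ j, ω j ^ 2 = ∑ j, η j ^ 2 := by
    rw [← EuclideanSpace.real_norm_sq_eq, ← EuclideanSpace.real_norm_sq_eq, h]
  rw [← sub_eq_zero]
  simp only [diagSqDist, ← Finset.sum_sub_distrib]
  have h3 : ∑ j, (t - s) * (ω j ^ 2 - η j ^ 2) = 0 := by
    rw [← Finset.mul_sum, Finset.sum_sub_distrib, h2, sub_self, mul_zero]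
  rw [← h3]
  refine Finset.sum_congr rfl fun j _ => ?_
  have e1 := Real.sq_sqrt (hs j)
  have e2 := Real.sq_sqrt (ht j)
  linear_combination (ω j ^ 2 - η j ^ 2) * (e2 - e1)

theorem shellPotential_sqrt_swap {b : Fin N → ℝ} {s t : ℝ} (hs : ∀ j, 0 ≤ b j + s)
    (ht : ∀ j, 0 ≤ b j + t) {ω : 𝔼} (h : ‖ω‖ = 1) :
    shellPotential (fun j => √(b j + s)) (fun j => √(b j + t) * ω j) =
      shellPotential (fun j => √(b j + t)) (fun j => √(b j + s) * ω j) := by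
  refine integral_congr_ae (Eventually.of_forall fun η => ?_)
  simp only [diagSqDist_sqrt_swap hs ht (h.trans (norm_eq_of_mem_sphere η).symm)]

theorem diagSqDist_sqrt_mul_ne_zero {b : Fin N → ℝ} (hb : ∀ j, 0 ≤ b j) {s t : ℝ} (hs : 0 ≤ s)
    (hst : s < t) {ω z : 𝔼} (hω : 1 ≤ ‖ω‖) (hz : ‖z‖ ≤ 1) :
    diagSqDist (fun j => √(b j + s)) (fun j => √(b j + t) * ω j) z ≠ 0 := by
  rw [diagSqDist_ne_zero_iff]
  by_contra! h
  have hω2 : 1 ≤ ∑ j, ω j ^ 2 := by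
    rw [← EuclideanSpace.real_norm_sq_eq]
    exact one_le_pow₀ hω
  have hz2 : ∑ j, z j ^ 2 ≤ 1 := by
    rw [← EuclideanSpace.real_norm_sq_eq]
    exact pow_le_one₀ (norm_nonneg _) hz
  have hsq : ∀ j, (b j + t) * ω j ^ 2 = (b j + s) * z j ^ 2 := fun j => by
    have := congrArg (· ^ 2) (h j)
    simpa only [mul_pow, Real.sq_sqrt (by linarith [hb j] : 0 ≤ b j + t),
      Real.sq_sqrt (by linarith [hb j] : 0 ≤ b j + s)] using this
  have hle : ∀ j, ω j ^ 2 ≤ z j ^ 2 := fun j => by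
    nlinarith [hsq j, hb j, mul_nonneg (sub_nonneg.2 hst.le) (sq_nonneg (z j))]
  obtain ⟨j, -, hj⟩ : ∃ j ∈ Finset.univ, ω j ^ 2 ≠ 0 := by
    by_contra! h0
    rw [Finset.sum_congr rfl h0] at hω2
    simp at hω2
    linarith
  have hj' : 0 < ω j ^ 2 := (sq_nonneg _).lt_of_ne' hj
  have hlt : ω j ^ 2 < z j ^ 2 := by
    have := hsq j
    nlinarith [hb j, hle j]
  exact absurd (Finset.sum_lt_sum (fun j _ => hle j) ⟨j, Finset.mem_univ j, hlt⟩)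
    (hz2.trans hω2).not_gt

theorem shellPotential_sqrt_mul_eq (hN : 0 < N) {b : Fin N → ℝ} (hb : ∀ j, 0 ≤ b j) {s t : ℝ}
    (hs : 0 ≤ s) (hst : s < t) {ω : 𝔼} (hω : ‖ω‖ = 1) :
    shellPotential (fun j => √(b j + t)) (fun j => √(b j + s) * ω j) =
      shellPotential (fun j => √(b j)) (fun j => √(b j + t) * ω j) := by
  rw [← shellPotential_sqrt_swap (fun j => by linarith [hb j]) (fun j => by linarith [hb j]) hω]
  exact shellPotential_sqrt_add_eq hN hb (fun r hr z hz => diagSqDist_sqrt_mul_ne_zero hb hr.1 hr.2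
    hω.ge (by simpa using hz)) ⟨hs, hst⟩

theorem integral_sphere_diagSqDist_add (hN : 0 < N) {c x : Fin N → ℝ} {η : 𝔼} {r : ℝ} (hr : 0 < r)
    (h : (2 * r) ^ 2 ≤ diagSqDist c x η) :
    ∫ ω : Metric.sphere (0 : 𝔼) 1, diagSqDist c (fun j => x j + r * (ω : 𝔼) j) η ^ (1 - N / 2 : ℝ)
      ∂(volume : Measure 𝔼).toSphere =
      (volume : Measure 𝔼).toSphere.real univ * diagSqDist c x η ^ (1 - N / 2 : ℝ) := by
  have key := shellPotential_sqrt_add_eq hN (b := fun _ => 0) (x := fun j => c j * η j - x j)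
    (T := (2 * r) ^ 2) (fun _ => le_rfl) (fun s hs z hz => ?_)
    (s := r ^ 2) ⟨by positivity, by nlinarith⟩
  · rw [shellPotential, shellPotential] at key
    refine Eq.trans (integral_congr_ae (Eventually.of_forall fun ω => ?_)) (key.trans ?_)
    · simp only [diagSqDist, zero_add, Real.sqrt_sq hr.le]
      congr 1
      exact Finset.sum_congr rfl fun j _ => by ring
    · simp only [diagSqDist, Real.sqrt_zero, zero_mul, sub_zero, integral_const, smul_eq_mul]
      congr 2
      exact Finset.sum_congr rfl fun j _ => by ring
  · rw [diagSqDist_ne_zero_iff]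
    by_contra! h0
    have h1 : diagSqDist c x η = s * ‖z‖ ^ 2 := by
      rw [EuclideanSpace.real_norm_sq_eq, Finset.mul_sum, diagSqDist]
      refine Finset.sum_congr rfl fun j _ => ?_
      have := h0 j
      simp only [zero_add] at this
      rw [← neg_sub, this, neg_sq, mul_pow, Real.sq_sqrt hs.1]
    have h2 : ‖z‖ ^ 2 ≤ 1 := pow_le_one₀ (norm_nonneg _) (by simpa using hz)
    nlinarith [hs.1, hs.2]

theorem shellPotential_mean_value (hN : 0 < N) {c : Fin N → ℝ} {p : 𝔼} {r : ℝ} (hr : 0 < r)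
    (h : ∀ q ∈ Metric.closedBall p (2 * r), ∀ η : Metric.sphere (0 : 𝔼) 1,
      diagSqDist c q η ≠ 0) :
    ∫ ω : Metric.sphere (0 : 𝔼) 1, shellPotential c (p + r • (ω : 𝔼))
      ∂(volume : Measure 𝔼).toSphere =
      (volume : Measure 𝔼).toSphere.real univ * shellPotential c p := by
  have hmem : ∀ ω : Metric.sphere (0 : 𝔼) 1, p + r • (ω : 𝔼) ∈ Metric.closedBall p (2 * r) :=
    fun ω => by
      rw [Metric.mem_closedBall, dist_eq_norm, add_sub_cancel_left, norm_smul,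
        norm_eq_of_mem_sphere, Real.norm_of_nonneg hr.le]
      linarith
  have hfar : ∀ η : Metric.sphere (0 : 𝔼) 1, (2 * r) ^ 2 ≤ diagSqDist c p η := fun η => by
    by_contra! hlt
    refine h (WithLp.toLp 2 fun j => c j * (η : 𝔼) j) ?_ η (by simp [diagSqDist])
    rw [Metric.mem_closedBall, dist_comm, EuclideanSpace.dist_eq]
    refine Real.sqrt_le_iff.2 ⟨by positivity, hlt.le.trans' (le_of_eq ?_)⟩
    simp [diagSqDist, Real.dist_eq]
  have hcont : Continuous (Function.uncurry fun ω η : Metric.sphere (0 : 𝔼) 1 =>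
      diagSqDist c (p + r • (ω : 𝔼)).ofLp η ^ (1 - N / 2 : ℝ)) := by
    refine Continuous.rpow_const ?_ fun q => Or.inl (h _ (hmem q.1) q.2)
    unfold diagSqDist
    fun_prop
  simp only [shellPotential]
  rw [integral_integral_swap, ← integral_const_mul]
  · refine integral_congr_ae (Eventually.of_forall fun η => ?_)
    exact integral_sphere_diagSqDist_add hN hr (hfar η)
  · simpa using hcont.continuousOn.integrableOn_compact
      (μ := (volume : Measure 𝔼).toSphere.prod (volume : Measure 𝔼).toSphere) isCompact_univ

theorem shellPotential_sqrt_mul_eq_zero (hN : 0 < N) {b : Fin N → ℝ} (hb : ∀ j, 0 ≤ b j) {t : ℝ}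
    (ht : 0 < t) {ω : 𝔼} (hω : ‖ω‖ = 1) :
    shellPotential (fun j => √(b j)) (fun j => √(b j + t) * ω j) =
      shellPotential (fun j => √(b j + t)) 0 := by
  set s := t / 2 with hs
  have hs0 : 0 < s := half_pos ht
  have hst : s < t := half_lt_self ht
  have hbs : ∀ j, 0 < b j + s := fun j => by linarith [hb j]
  have hsq : ∀ j, √(b j + s) ≠ 0 := fun j => (Real.sqrt_pos.2 (hbs j)).ne'
  let Φ : 𝔼 → 𝔼 := fun z => WithLp.toLp 2 fun j => √(b j + s) * z j
  let Ψ : 𝔼 → 𝔼 := fun z => WithLp.toLp 2 fun j => (√(b j + s))⁻¹ * z j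
  have hΦ : Continuous Φ := by fun_prop
  have hΨ : Continuous Ψ := by fun_prop
  have hΦΨ : ∀ p, Φ (Ψ p) = p := fun p => by
    ext j
    simp [Φ, Ψ, hsq j]
  have hΨΦ : ∀ p, Ψ (Φ p) = p := fun p => by
    ext j
    simp [Φ, Ψ, hsq j]
  set K : Set 𝔼 := Φ '' Metric.closedBall 0 1 with hK
  have hmemK : ∀ p, ‖Ψ p‖ ≤ 1 → p ∈ K := fun p hp => ⟨Ψ p, by simpa using hp, hΦΨ p⟩
  have hne : ∀ p ∈ K, ∀ η ∈ Metric.sphere (0 : 𝔼) 1,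
      diagSqDist (fun j => √(b j + t)) p η ≠ 0 := by
    rintro _ ⟨z, hz, rfl⟩ η hη
    have h := diagSqDist_sqrt_mul_ne_zero hb hs0.le hst (norm_eq_of_mem_sphere ⟨η, hη⟩).ge
      (z := z) (by simpa using hz)
    rw [diagSqDist_ne_zero_iff] at h ⊢
    obtain ⟨j, hj⟩ := h
    exact ⟨j, hj.symm⟩
  have hval : ∀ z : 𝔼, ‖z‖ = 1 → shellPotential (fun j => √(b j + t)) (Φ z) =
      shellPotential (fun j => √(b j)) (fun j => √(b j + t) * z j) := fun z hz =>
    shellPotential_sqrt_mul_eq hN hb hs0.le hst hz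
  have hzero := eq_map_zero_of_mean_value (volume : Measure 𝔼) (K := K)
    ((isCompact_closedBall 0 1).image hΦ) ⟨0, by simp, by ext j; simp [Φ]⟩
    (g := fun p => shellPotential (fun j => √(b j + t)) p) ?_ ?_ ?_
    (p := Φ ω) ⟨ω, by simp [hω], rfl⟩
  · rw [← hval ω hω]
    exact hzero
  · have := continuousOn_setIntegral_of_isCompact (Y := Metric.sphere (0 : 𝔼) 1)
      (ν := (volume : Measure 𝔼).toSphere) (U := K) isCompact_univ MeasurableSet.univ
      (f := fun p ω => diagSqDist (fun j => √(b j + t)) p.ofLp ω ^ (1 - N / 2 : ℝ)) ?_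
    · simpa [shellPotential] using this
    · refine ContinuousOn.rpow_const ?_ fun p hp => Or.inl (hne p.1 hp.1 p.2 p.2.2)
      unfold diagSqDist
      fun_prop
  · rintro _ ⟨z, hz, rfl⟩ hint
    have hz1 : ‖z‖ = 1 := by
      refine (le_antisymm (by simpa using hz)) (not_lt.1 fun hlt => hint ?_)
      have ho : IsOpen (Ψ ⁻¹' Metric.ball 0 1) := Metric.isOpen_ball.preimage hΨ
      refine interior_maximal (fun p hp => hmemK p ?_) ho ?_
      · simpa using le_of_lt (mem_ball_zero_iff.1 hp)
      · simpa [hΨΦ] using hlt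
    have hz2 : ∑ j, z j ^ 2 = 1 := by
      rw [← EuclideanSpace.real_norm_sq_eq, hz1, one_pow]
    refine ⟨WithLp.toLp 2 fun j => √(b j) * z j, hmemK _ ?_, ?_, ?_⟩
    · refine Real.sqrt_le_one.2 ?_ |> (EuclideanSpace.norm_eq _).le.trans
      rw [← hz2]
      refine Finset.sum_le_sum fun j _ => ?_
      simp only [Ψ, Real.norm_eq_abs, sq_abs, mul_pow, inv_pow, Real.sq_sqrt (hbs j).le,
        Real.sq_sqrt (hb j)]
      rw [← mul_assoc]
      refine mul_le_of_le_one_left (sq_nonneg _) ?_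
      rw [inv_mul_le_iff₀ (hbs j)]
      linarith
    · have h := shellPotential_sqrt_mul_eq hN hb le_rfl ht hz1
      simp only [add_zero] at h
      exact h.trans (hval z hz1).symm
    · rw [EuclideanSpace.norm_eq, EuclideanSpace.norm_eq]
      refine Real.sqrt_lt_sqrt (Finset.sum_nonneg fun _ _ => sq_nonneg _) ?_
      simp only [Φ, Real.norm_eq_abs, sq_abs, mul_pow, Real.sq_sqrt (hbs _).le,
        Real.sq_sqrt (hb _), add_mul, Finset.sum_add_distrib, ← Finset.mul_sum, hz2]
      linarith
  · intro p r hr hsub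
    exact shellPotential_mean_value hN hr fun q hq η => hne q (hsub hq) η η.2

end Confocal

section BallPotential

variable {N : ℕ}

local notation "𝔼" => EuclideanSpace ℝ (Fin N)

/-- The Newtonian potential at `x` of the image of Lebesgue measure on the unit ball under the
diagonal map with entries `c`. -/
noncomputable def ballPotential (c x : Fin N → ℝ) : ℝ :=
  ∫ z in Metric.closedBall (0 : 𝔼) 1, diagSqDist c x z ^ (1 - N / 2 : ℝ)

theorem diagSqDist_smul (c x : Fin N → ℝ) (t : ℝ) (z : 𝔼) :
    diagSqDist c (t • x) (t • z) = t ^ 2 * diagSqDist c x z := by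
  simp only [diagSqDist, Finset.mul_sum]
  exact Finset.sum_congr rfl fun j _ => by simp; ring

theorem setIntegral_closedBall_eq_setIntegral_ball (hN : 0 < N) (f : 𝔼 → ℝ) :
    ∫ z in Metric.closedBall (0 : 𝔼) 1, f z = ∫ z in Metric.ball (0 : 𝔼) 1, f z := by
  have : Nonempty (Fin N) := ⟨⟨0, hN⟩⟩
  refine setIntegral_congr_set (ae_eq_of_subset_of_measure_ge Metric.ball_subset_closedBall
    (Measure.addHaar_closedBall_eq_addHaar_ball _ _ _).le
    Metric.isOpen_ball.measurableSet.nullMeasurableSet ?_).symm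
  exact (isCompact_closedBall _ _).measure_lt_top.ne

theorem ballPotential_smul (hN : 0 < N) (c x : Fin N → ℝ) {t : ℝ} (ht : 0 < t) :
    ballPotential c (t • x) =
      t ^ 2 * ∫ z in Metric.ball (0 : 𝔼) t⁻¹, diagSqDist c x z ^ (1 - N / 2 : ℝ) := by
  have h := Measure.setIntegral_comp_smul_of_pos (volume : Measure 𝔼)
    (fun z => diagSqDist c (t • x) z ^ (1 - N / 2 : ℝ)) (Metric.ball (0 : 𝔼) t⁻¹) ht
  rw [smul_ball ht.ne', smul_zero, Real.norm_of_nonneg ht.le, mul_inv_cancel₀ ht.ne',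
    ← setIntegral_closedBall_eq_setIntegral_ball hN, ← ballPotential, smul_eq_mul,
    eq_inv_mul_iff_mul_eq₀ (by positivity)] at h
  rw [← h, ← integral_const_mul, ← integral_const_mul]
  refine integral_congr_ae (Eventually.of_forall fun z => ?_)
  simp only [diagSqDist_smul, finrank_euclideanSpace, Fintype.card_fin]
  rw [Real.mul_rpow (sq_nonneg t) (diagSqDist_nonneg _ _ _), ← mul_assoc, ← Real.rpow_natCast t 2,
    ← Real.rpow_mul ht.le, ← Real.rpow_natCast t N, ← Real.rpow_add ht]
  congr 2
  push_cast
  ring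

theorem hasDerivAt_ballPotential_smul (hN : 0 < N) {c x : Fin N → ℝ}
    (hx : ∀ z ∈ Metric.closedBall (0 : 𝔼) 1, diagSqDist c x z ≠ 0) :
    HasDerivAt (fun t : ℝ => ballPotential c (t • x))
      (2 * ballPotential c x - shellPotential c x) 1 := by
  have : Nonempty (Fin N) := ⟨⟨0, hN⟩⟩
  obtain ⟨δ, hδ, hsub⟩ := (isCompact_closedBall (0 : 𝔼) 1).exists_thickening_subset_open
    (isOpen_compl_singleton.preimage (contDiff_diagSqDist c x).continuous (t := {0}ᶜ)) hx
  rw [thickening_closedBall hδ zero_le_one] at hsub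
  set k : 𝔼 → ℝ := fun z => diagSqDist c x z ^ (1 - N / 2 : ℝ) with hk
  have hkc : ContinuousOn k (Metric.ball 0 (δ + 1)) :=
    (contDiff_diagSqDist c x).continuous.continuousOn.rpow_const fun z hz => Or.inl (hsub hz)
  set S : ℝ → ℝ := fun r => ∫ ω : Metric.sphere (0 : 𝔼) 1, k (r • (ω : 𝔼))
    ∂(volume : Measure 𝔼).toSphere with hS
  have hmem : ∀ r ∈ Ioo (-(δ + 1)) (δ + 1), ∀ ω : Metric.sphere (0 : 𝔼) 1,
      r • (ω : 𝔼) ∈ Metric.ball (0 : 𝔼) (δ + 1) := fun r hr ω => by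
    simpa [norm_smul, abs_lt] using hr
  have hSc : ContinuousOn S (Ioo (-(δ + 1)) (δ + 1)) := by
    have := continuousOn_setIntegral_of_isCompact (Y := Metric.sphere (0 : 𝔼) 1)
      (ν := (volume : Measure 𝔼).toSphere) (U := Ioo (-(δ + 1)) (δ + 1)) isCompact_univ
      MeasurableSet.univ
      (f := fun r ω => k (r • (ω : 𝔼))) (hkc.comp (by fun_prop) fun p hp => hmem p.1 hp.1 p.2)
    simpa using this
  set h : ℝ → ℝ := fun r => r ^ (N - 1) * S r with hh
  have hhc : ContinuousOn h (Ioo (-(δ + 1)) (δ + 1)) := by fun_prop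
  have h1mem : (1 : ℝ) ∈ Ioo (-(δ + 1)) (δ + 1) := ⟨by linarith, by linarith⟩
  have hFTC : HasDerivAt (fun R => ∫ r in (0 : ℝ)..R, h r) (shellPotential c x) 1 := by
    have := intervalIntegral.integral_hasDerivAt_right (f := h) (a := 0) (b := 1)
      (ContinuousOn.intervalIntegrable (hhc.mono ?_))
      (hhc.stronglyMeasurableAtFilter isOpen_Ioo _ h1mem)
      (hhc.continuousAt (isOpen_Ioo.mem_nhds h1mem))
    · simpa [hh, hS, hk, shellPotential] using this
    · rw [uIcc_of_le zero_le_one]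
      exact fun r hr => ⟨by linarith [hr.1], by linarith [hr.2]⟩
  have heq : ∀ t : ℝ, 0 < t → t⁻¹ < δ + 1 →
      ballPotential c (t • x) = t ^ 2 * ∫ r in (0 : ℝ)..t⁻¹, h r := fun t ht hlt => by
    rw [ballPotential_smul hN c x ht, setIntegral_ball_eq_intervalIntegral_sphere _ (by positivity)]
    · simp [hh, hS, hk]
    · refine (ContinuousOn.integrableOn_compact (isCompact_closedBall (0 : 𝔼) t⁻¹)
        (hkc.mono ?_)).mono_set Metric.ball_subset_closedBall
      exact Metric.closedBall_subset_ball hlt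
  have hJ : ballPotential c x = ∫ r in (0 : ℝ)..1, h r := by
    simpa using heq 1 one_pos (by simpa using hδ)
  have hder : HasDerivAt (fun t : ℝ => t ^ 2 * ∫ r in (0 : ℝ)..t⁻¹, h r)
      (2 * ballPotential c x - shellPotential c x) 1 := by
    have e1 : HasDerivAt (fun t : ℝ => t⁻¹) (-1) 1 := by
      simpa using hasDerivAt_inv (one_ne_zero (α := ℝ))
    have e2 := HasDerivAt.comp (h₂ := fun R => ∫ r in (0 : ℝ)..R, h r) 1 (by simpa using hFTC) e1
    refine ((hasDerivAt_pow 2 (1 : ℝ)).fun_mul e2).congr_deriv ?_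
    simp [hJ]
    ring
  refine hder.congr_of_eventuallyEq ?_
  have ev : ∀ᶠ t : ℝ in 𝓝 1, t⁻¹ < δ + 1 :=
    (continuousAt_inv₀ one_ne_zero).eventually_lt continuousAt_const (by simpa using hδ)
  filter_upwards [ev, lt_mem_nhds (zero_lt_one (α := ℝ))] with t h1 h2
  exact heq t h2 h1

end BallPotential

theorem integral_eq_prod_mul_integral_mul {ι : Type*} [Fintype ι] {d : ι → ℝ} (hd : ∀ j, 0 < d j)
    (G : (ι → ℝ) → ℝ) :
    ∫ y, G y = (∏ j, d j) * ∫ z : ι → ℝ, G (fun j => d j * z j) := by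
  classical
  have hdet : (Matrix.diagonal d).det = ∏ j, d j := Matrix.det_diagonal
  have hpos : 0 < ∏ j, d j := Finset.prod_pos fun j _ => hd j
  have hfun : ⇑(Matrix.toLin' (Matrix.diagonal d)) = fun z j => d j * z j := by
    ext z j
    simp [Matrix.mulVec_diagonal]
  have hemb : MeasurableEmbedding fun (z : ι → ℝ) j => d j * z j :=
    Continuous.measurableEmbedding (by fun_prop) fun z w h =>
      funext fun j => mul_left_cancel₀ (hd j).ne' (congrFun h j)
  have hvol := Real.smul_map_diagonal_volume_pi (D := d) (by rw [hdet]; exact hpos.ne')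
  conv_lhs => rw [← hvol]
  rw [hdet, hfun, integral_smul_measure, hemb.integral_map, abs_of_pos hpos,
    ENNReal.toReal_ofReal hpos.le, smul_eq_mul]

theorem sqrt_zpow_two_sub {Q : ℝ} (hQ : 0 ≤ Q) (N : ℕ) :
    √Q ^ (2 - (N : ℤ)) = Q ^ (1 - N / 2 : ℝ) := by
  rw [Real.sqrt_eq_rpow, ← Real.rpow_intCast, ← Real.rpow_mul hQ]
  congr 1
  push_cast
  ring

section Disintegration

variable {n : ℕ}

theorem integral_indicator_sq_add_le_one (s v : ℝ) :
    ∫ t : ℝ, {t : ℝ | t ^ 2 + s ≤ 1}.indicator (fun _ => v) t = 2 * √(1 - s) * v := by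
  have hset : {t : ℝ | t ^ 2 + s ≤ 1} = if s ≤ 1 then Icc (-√(1 - s)) (√(1 - s)) else ∅ := by
    split_ifs with h
    · ext t
      rw [mem_ofPred_eq, mem_Icc, ← abs_le, ← le_sub_iff_add_le,
        ← Real.sqrt_le_sqrt_iff (by linarith), Real.sqrt_sq_eq_abs]
    · ext t
      simp only [mem_ofPred_eq, mem_empty_iff_false, iff_false, not_le]
      nlinarith [sq_nonneg t]
  rw [hset]
  split_ifs with h
  · rw [integral_indicator measurableSet_Icc, setIntegral_const, Real.volume_real_Icc_of_le
      (by linarith [Real.sqrt_nonneg (1 - s)]), smul_eq_mul]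
    ring
  · simp [Real.sqrt_eq_zero_of_nonpos (by linarith : 1 - s ≤ 0)]

theorem setIntegral_closedBall_comp_castSucc {F : (Fin n → ℝ) → ℝ}
    (hF : IntegrableOn (fun z : EuclideanSpace ℝ (Fin (n + 1)) => F fun j => z j.castSucc)
      (Metric.closedBall 0 1)) :
    ∫ z in Metric.closedBall (0 : EuclideanSpace ℝ (Fin (n + 1))) 1, F (fun j => z j.castSucc) =
      ∫ y : Fin n → ℝ, 2 * √(1 - ∑ j, y j ^ 2) * F y := by
  set e := MeasurableEquiv.piFinSuccAbove (fun _ : Fin (n + 1) => ℝ) (Fin.last n)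
  have he : MeasurePreserving (fun p : ℝ × (Fin n → ℝ) => WithLp.toLp 2 (e.symm p))
      volume volume :=
    (PiLp.volume_preserving_toLp (Fin (n + 1))).comp
      (volume_preserving_piFinSuccAbove (fun _ : Fin (n + 1) => ℝ) (Fin.last n)).symm
  have hemb : MeasurableEmbedding (fun p : ℝ × (Fin n → ℝ) => WithLp.toLp 2 (e.symm p)) :=
    (MeasurableEquiv.toLp 2 _).measurableEmbedding.comp e.symm.measurableEmbedding
  have hind : ∀ t y, (Metric.closedBall (0 : EuclideanSpace ℝ (Fin (n + 1))) 1).indicator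
      (fun z => F fun j => z j.castSucc) (WithLp.toLp 2 (e.symm (t, y))) =
      {t : ℝ | t ^ 2 + ∑ j, y j ^ 2 ≤ 1}.indicator (fun _ => F y) t := by
    intro t y
    have h1 : ∀ j : Fin n, e.symm (t, y) j.castSucc = y j := fun j => by
      simp [e, MeasurableEquiv.piFinSuccAbove, Fin.insertNthEquiv]
    have h2 : e.symm (t, y) (Fin.last n) = t := by
      simp [e, MeasurableEquiv.piFinSuccAbove, Fin.insertNthEquiv]
    have h3 : WithLp.toLp 2 (e.symm (t, y)) ∈
        Metric.closedBall (0 : EuclideanSpace ℝ (Fin (n + 1))) 1 ↔ t ^ 2 + ∑ j, y j ^ 2 ≤ 1 := by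
      rw [mem_closedBall_zero_iff, ← sq_le_one_iff₀ (norm_nonneg _),
        EuclideanSpace.real_norm_sq_eq, Fin.sum_univ_castSucc, add_comm]
      simp only [h1, h2]
    simp only [indicator, h3, h1, mem_ofPred_eq]
  rw [← integral_indicator Metric.isClosed_closedBall.measurableSet, ← he.integral_comp hemb,
    Measure.volume_eq_prod, integral_prod_symm]
  · simp only [hind, integral_indicator_sq_add_le_one]
  · rw [← Measure.volume_eq_prod]
    exact he.integrable_comp_emb hemb |>.2
      ((integrable_indicator_iff Metric.isClosed_closedBall.measurableSet).2 hF)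

theorem setIntegral_focalEllipsoid_eq_ballPotential {b : Fin n → ℝ} (hb : ∀ j, 0 < b j) (A : ℝ)
    {c : Fin (n + 1) → ℝ} (hc : ∀ j : Fin n, c j.castSucc = √(b j)) (hlast : c (Fin.last n) = 0)
    {x : Fin (n + 1) → ℝ} (hx : ∀ z ∈ Metric.closedBall 0 1, diagSqDist c x z ≠ 0) :
    ∫ y in {y : Fin n → ℝ | ∑ j, y j ^ 2 / b j ≤ 1},
      2 * A * (∏ j, b j) ^ (-(1 / 2) : ℝ) * √(1 - ∑ j, y j ^ 2 / b j) *
        √(∑ i, (x i - if h : (i : ℕ) < n then y ⟨i, h⟩ else 0) ^ 2) ^ (2 - ((n + 1 : ℕ) : ℤ)) =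
      A * ballPotential c x := by
  set K : (Fin n → ℝ) → ℝ := fun y =>
    √(∑ i : Fin (n + 1), (x i - if h : (i : ℕ) < n then y ⟨i, h⟩ else 0) ^ 2) ^
      (2 - ((n + 1 : ℕ) : ℤ)) with hK
  have hKz : ∀ z : EuclideanSpace ℝ (Fin (n + 1)), K (fun j => √(b j) * z j.castSucc) =
      diagSqDist c x z ^ (1 - (n + 1 : ℕ) / 2 : ℝ) := by
    intro z
    suffices hQ : ∑ i : Fin (n + 1), (x i -
        if h : (i : ℕ) < n then √(b ⟨i, h⟩) * z (Fin.castSucc ⟨i, h⟩)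
        else 0) ^ 2 = diagSqDist c x z by
      rw [← sqrt_zpow_two_sub (diagSqDist_nonneg _ _ _), ← hQ]
    rw [diagSqDist]
    refine Finset.sum_congr rfl fun i _ => ?_
    refine Fin.lastCases ?_ (fun j => ?_) i
    · simp [hlast]
    · simp [hc]
  have hint : IntegrableOn (fun z : EuclideanSpace ℝ (Fin (n + 1)) =>
      K (fun j => √(b j) * z j.castSucc)) (Metric.closedBall 0 1) := by
    simp only [hKz]
    exact ((contDiff_diagSqDist c x).continuous.continuousOn.rpow_const fun z hz =>
      Or.inl (hx z hz)).integrableOn_compact (isCompact_closedBall _ _)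
  have hmeas : MeasurableSet {y : Fin n → ℝ | ∑ j, y j ^ 2 / b j ≤ 1} :=
    measurableSet_le (by fun_prop) measurable_const
  have hzero : ∀ y : Fin n → ℝ, {y : Fin n → ℝ | ∑ j, y j ^ 2 / b j ≤ 1}.indicator (fun y =>
      2 * A * (∏ j, b j) ^ (-(1 / 2) : ℝ) * √(1 - ∑ j, y j ^ 2 / b j) * K y) y =
      2 * A * (∏ j, b j) ^ (-(1 / 2) : ℝ) * √(1 - ∑ j, y j ^ 2 / b j) * K y := fun y => by
    refine indicator_apply_eq_self.2 fun hy => ?_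
    have hy' : 1 < ∑ j, y j ^ 2 / b j := not_le.1 hy
    rw [Real.sqrt_eq_zero_of_nonpos (by linarith)]
    ring
  have hprod : 0 < ∏ j, b j := Finset.prod_pos fun j _ => hb j
  have hcancel : (∏ j, √(b j)) * (∏ j, b j) ^ (-(1 / 2) : ℝ) = 1 := by
    have h1 : ∏ j, √(b j) = √(∏ j, b j) := by
      simp only [Real.sqrt_eq_rpow]
      exact Real.finsetProd_rpow _ _ (fun j _ => (hb j).le) _
    rw [h1, Real.sqrt_eq_rpow, ← Real.rpow_add hprod]
    norm_num
  rw [← integral_indicator hmeas, integral_congr_ae (Eventually.of_forall hzero),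
    integral_eq_prod_mul_integral_mul fun j => Real.sqrt_pos.2 (hb j), ballPotential]
  simp only [← hKz]
  rw [setIntegral_closedBall_comp_castSucc (F := fun y => K fun j => √(b j) * y j) hint,
    ← integral_const_mul, ← integral_const_mul]
  refine integral_congr_ae (Eventually.of_forall fun y => ?_)
  have hs : ∀ j, (√(b j) * y j) ^ 2 / b j = y j ^ 2 := fun j => by
    rw [mul_pow, Real.sq_sqrt (hb j).le, mul_div_cancel_left₀ _ (hb j).ne']
  simp only [hs]
  linear_combination 2 * A * √(1 - ∑ j, y j ^ 2) * K (fun j => √(b j) * y j) * hcancel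

end Disintegration

section Evaluation

variable {N : ℕ}

local notation "𝔼" => EuclideanSpace ℝ (Fin N)

theorem shellPotential_pos (hN : 0 < N) {c x : Fin N → ℝ}
    (hx : ∀ z ∈ Metric.sphere (0 : 𝔼) 1, diagSqDist c x z ≠ 0) : 0 < shellPotential c x := by
  have : Nonempty (Fin N) := ⟨⟨0, hN⟩⟩
  obtain ⟨ω, hω⟩ := (NormedSpace.sphere_nonempty (x := (0 : 𝔼)) (r := 1)).2 zero_le_one
  have hpos : ∀ z ∈ Metric.sphere (0 : 𝔼) 1, 0 < diagSqDist c x z := fun z hz =>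
    (diagSqDist_nonneg c x z).lt_of_ne' (hx z hz)
  have hnn : ∀ η : Metric.sphere (0 : 𝔼) 1, 0 ≤ diagSqDist c x η ^ (1 - N / 2 : ℝ) := fun η =>
    Real.rpow_nonneg (diagSqDist_nonneg _ _ _) _
  refine (integral_nonneg hnn).lt_of_ne' fun h => ?_
  have h0 := eq_zero_of_integral_sphere_eq_zero (volume : Measure 𝔼)
    (f := fun η => diagSqDist c x η ^ (1 - N / 2 : ℝ)) (Continuous.rpow_const
      ((contDiff_diagSqDist c x).continuous.comp continuous_subtype_val)
      fun η => Or.inl (hx η η.2)) hnn h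
  exact (Real.rpow_pos_of_pos (hpos ω hω) _).ne' (congrFun h0 ⟨ω, hω⟩)

theorem ballPotential_zero (hN : 0 < N) (c : Fin N → ℝ) :
    ballPotential c 0 = 1 / 2 * shellPotential c 0 := by
  have : Nonempty (Fin N) := ⟨⟨0, hN⟩⟩
  set φ : ℝ → ℝ := (Iic 1).indicator fun r => (r ^ 2) ^ (1 - N / 2 : ℝ) with hφ
  have hG : ∀ p : Metric.sphere (0 : 𝔼) 1 × Ioi (0 : ℝ), (Metric.closedBall (0 : 𝔼) 1).indicator
      (fun z => diagSqDist c 0 z ^ (1 - N / 2 : ℝ)) ((p.2 : ℝ) • (p.1 : 𝔼)) =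
      diagSqDist c 0 p.1 ^ (1 - N / 2 : ℝ) * φ p.2 := by
    rintro ⟨ω, r, hr⟩
    have hr' : 0 < r := hr
    have h1 : r • (ω : 𝔼) ∈ Metric.closedBall (0 : 𝔼) 1 ↔ r ∈ Iic (1 : ℝ) := by
      simp [norm_smul, abs_of_pos hr']
    have h2 := diagSqDist_smul c 0 r (ω : 𝔼)
    rw [smul_zero] at h2
    simp only [hφ, indicator, h1, h2]
    rw [Real.mul_rpow (sq_nonneg r) (diagSqDist_nonneg _ _ _)]
    split_ifs <;> ring
  have hint : ∫ r in Ioi (0 : ℝ), r ^ (N - 1) * φ r = 1 / 2 := by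
    have h1 : ∀ r ∈ Ioi (0 : ℝ), r ^ (N - 1) * φ r = (Iic (1 : ℝ)).indicator (fun r => r) r := by
      intro r hr
      have hr' : 0 < r := hr
      have h2 : r ^ (N - 1) * (r ^ 2) ^ (1 - N / 2 : ℝ) = r := by
        rw [← Real.rpow_natCast r 2, ← Real.rpow_mul hr'.le, ← Real.rpow_natCast,
          ← Real.rpow_add hr', Nat.cast_sub hN]
        conv_rhs => rw [← Real.rpow_one r]
        congr 1
        push_cast
        ring
      simp only [hφ, indicator]
      split_ifs <;> simp [h2]
    rw [setIntegral_congr_fun measurableSet_Ioi h1, setIntegral_indicator measurableSet_Iic,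
      Ioi_inter_Iic, ← intervalIntegral.integral_of_le zero_le_one, integral_id]
    norm_num
  rw [ballPotential, ← integral_indicator Metric.isClosed_closedBall.measurableSet,
    integral_eq_integral_sphere_prod, integral_congr_ae (Eventually.of_forall hG),
    integral_prod_mul (fun ω : Metric.sphere (0 : 𝔼) 1 => diagSqDist c 0 ω ^ (1 - N / 2 : ℝ))
      (fun r : Ioi (0 : ℝ) => φ r), integral_volumeIoiPow, finrank_euclideanSpace,
    Fintype.card_fin, hint, shellPotential, mul_comm]

theorem setIntegral_ellipsoid_eq_ballPotential {a : Fin N → ℝ} (ha : ∀ j, 0 < a j) :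
    ∫ y in {x : Fin N → ℝ | ∑ j, x j ^ 2 / a j ^ 2 ≤ 1}, √(∑ j, y j ^ 2) ^ (2 - (N : ℤ)) =
      (∏ j, a j) * ballPotential a 0 := by
  rw [← integral_indicator (measurableSet_le (by fun_prop) measurable_const),
    integral_eq_prod_mul_integral_mul ha, ballPotential,
    ← integral_indicator Metric.isClosed_closedBall.measurableSet,
    ← (PiLp.volume_preserving_toLp (Fin N)).integral_comp
      (MeasurableEquiv.toLp 2 _).measurableEmbedding]
  congr 1
  refine integral_congr_ae (Eventually.of_forall fun z => ?_)
  have h1 : ∀ j, (a j * z j) ^ 2 / a j ^ 2 = z j ^ 2 := fun j => by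
    rw [mul_pow, mul_div_cancel_left₀ _ (pow_pos (ha j) 2).ne']
  have h2 : WithLp.toLp 2 z ∈ Metric.closedBall (0 : 𝔼) 1 ↔ ∑ j, z j ^ 2 ≤ 1 := by
    rw [mem_closedBall_zero_iff, ← sq_le_one_iff₀ (norm_nonneg _), EuclideanSpace.real_norm_sq_eq]
  have h3 : diagSqDist a 0 (WithLp.toLp 2 z) = ∑ j, (a j * z j) ^ 2 := by
    simp [diagSqDist]
  simp only [indicator, mem_ofPred_eq, h1, h2]
  rw [← sqrt_zpow_two_sub (diagSqDist_nonneg _ _ _), h3]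

end Evaluation

section Kernel

open scoped ContDiff

variable {N : ℕ}

theorem hasFDerivAt_sum_sub_sq (v x : Fin N → ℝ) :
    HasFDerivAt (fun x : Fin N → ℝ => ∑ j, (x j - v j) ^ 2)
      (∑ j, (2 * (x j - v j)) • ContinuousLinearMap.proj (R := ℝ) (φ := fun _ : Fin N => ℝ) j)
      x := by
  refine HasFDerivAt.fun_sum fun j _ => ?_
  have h : HasFDerivAt (fun x : Fin N → ℝ => x j - v j)
      (ContinuousLinearMap.proj (R := ℝ) (φ := fun _ : Fin N => ℝ) j) x :=
    (hasFDerivAt_apply j x).sub_const (v j)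
  simpa using h.pow 2

theorem hasFDerivAt_sum_mul_sub (v x : Fin N → ℝ) :
    HasFDerivAt (fun x : Fin N → ℝ => ∑ j, v j * (x j - v j))
      (∑ j, v j • ContinuousLinearMap.proj (R := ℝ) (φ := fun _ : Fin N => ℝ) j) x :=
  HasFDerivAt.fun_sum fun j _ => ((hasFDerivAt_apply j x).sub_const (v j)).const_mul (v j)

/-- The value at `x` of `u - ½ x · ∇u`, for the Newtonian kernel `u` with pole `v`. -/
noncomputable def eulerKernel (v x : Fin N → ℝ) : ℝ :=
  (∑ j, (x j - v j) ^ 2) ^ (-(N / 2) : ℝ) *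
    (N / 2 * ∑ j, (x j - v j) ^ 2 + (N / 2 - 1) * ∑ j, v j * (x j - v j))

theorem fderiv_sum_sub_sq_rpow {v x : Fin N → ℝ} (hx : ∑ j, (x j - v j) ^ 2 ≠ 0) (q : ℝ)
    (i : Fin N) :
    fderiv ℝ (fun x : Fin N → ℝ => (∑ j, (x j - v j) ^ 2) ^ q) x (Pi.single i 1) =
      2 * (x i - v i) * q * (∑ j, (x j - v j) ^ 2) ^ (q - 1) := by
  rw [((hasFDerivAt_sum_sub_sq v x).rpow_const (p := q) (Or.inl hx)).fderiv]
  simp [Pi.single_apply]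
  ring

theorem sub_half_sum_fderiv_eq_eulerKernel {v x : Fin N → ℝ} (hx : ∑ j, (x j - v j) ^ 2 ≠ 0) :
    (∑ j, (x j - v j) ^ 2) ^ (1 - N / 2 : ℝ) - 1 / 2 * ∑ i, x i *
      fderiv ℝ (fun x : Fin N → ℝ => (∑ j, (x j - v j) ^ 2) ^ (1 - N / 2 : ℝ)) x (Pi.single i 1) =
      eulerKernel v x := by
  simp only [fderiv_sum_sub_sq_rpow hx]
  have h1 : ∑ i, x i * (2 * (x i - v i) * (1 - N / 2 : ℝ) *
      (∑ j, (x j - v j) ^ 2) ^ ((1 - N / 2 : ℝ) - 1)) = 2 * (1 - N / 2 : ℝ) *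
      (∑ j, (x j - v j) ^ 2) ^ (-(N / 2) : ℝ) *
      (∑ j, (x j - v j) ^ 2 + ∑ j, v j * (x j - v j)) := by
    rw [← Finset.sum_add_distrib, Finset.mul_sum,
      show (1 - N / 2 : ℝ) - 1 = -(N / 2) by ring]
    exact Finset.sum_congr rfl fun i _ => by ring
  rw [h1, eulerKernel, show (1 - N / 2 : ℝ) = -(N / 2) + 1 by ring, Real.rpow_add_one hx]
  ring

theorem fderiv_eulerKernel {v x : Fin N → ℝ} (hx : ∑ j, (x j - v j) ^ 2 ≠ 0) (i : Fin N) :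
    fderiv ℝ (eulerKernel v) x (Pi.single i 1) =
      (∑ j, (x j - v j) ^ 2) ^ (-(N / 2) - 1 : ℝ) * (-N * (x i - v i) *
        (N / 2 * ∑ j, (x j - v j) ^ 2 + (N / 2 - 1) * ∑ j, v j * (x j - v j))) +
      (∑ j, (x j - v j) ^ 2) ^ (-(N / 2) : ℝ) * (N * (x i - v i) + (N / 2 - 1) * v i) := by
  have h := ((hasFDerivAt_sum_sub_sq v x).rpow_const (p := (-(N / 2) : ℝ)) (Or.inl hx)).fun_mul
    (((hasFDerivAt_sum_sub_sq v x).const_mul (N / 2 : ℝ)).fun_add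
      ((hasFDerivAt_sum_mul_sub v x).const_mul (N / 2 - 1 : ℝ)))
  unfold eulerKernel
  rw [h.fderiv]
  simp [Pi.single_apply]
  ring

theorem lap_eulerKernel {v x : Fin N → ℝ} (hx : ∑ j, (x j - v j) ^ 2 ≠ 0) :
    lap (eulerKernel v) x = 0 := by
  set D : (Fin N → ℝ) → ℝ := fun x => ∑ j, (x j - v j) ^ 2 with hD
  set l : (Fin N → ℝ) → ℝ := fun x => ∑ j, v j * (x j - v j) with hl
  have hDx : D x ≠ 0 := hx
  have hev : ∀ᶠ y in 𝓝 x, D y ≠ 0 :=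
    (hasFDerivAt_sum_sub_sq v x).continuousAt.eventually_ne hx
  have key : ∀ i, fderiv ℝ (fun y => fderiv ℝ (eulerKernel v) y (Pi.single i 1)) x
      (Pi.single i 1) = D x ^ (-(N / 2) - 1 - 1 : ℝ) *
        ((N * (N + 2) * (N / 2 * D x + (N / 2 - 1) * l x)) * (x i - v i) ^ 2) -
        D x ^ (-(N / 2) - 1 : ℝ) * (N * (N / 2 * D x + (N / 2 - 1) * l x) +
        2 * N * (N * (x i - v i) ^ 2 + (N / 2 - 1) * (v i * (x i - v i)))) +
        D x ^ (-(N / 2) : ℝ) * N := by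
    intro i
    have hlin := (hasFDerivAt_apply (𝕜 := ℝ) (F' := fun _ : Fin N => ℝ) i x).sub_const (v i)
    have hDd := hasFDerivAt_sum_sub_sq v x
    have hc := (hDd.const_mul (N / 2 : ℝ)).fun_add
      ((hasFDerivAt_sum_mul_sub v x).const_mul (N / 2 - 1 : ℝ))
    have h := ((hDd.rpow_const (p := (-(N / 2) - 1 : ℝ)) (Or.inl hx)).fun_mul
      ((hlin.const_mul (-N : ℝ)).fun_mul hc)).fun_add
      ((hDd.rpow_const (p := (-(N / 2) : ℝ)) (Or.inl hx)).fun_mul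
        ((hlin.const_mul (N : ℝ)).add_const ((N / 2 - 1) * v i)))
    rw [Filter.EventuallyEq.fderiv_eq (hev.mono fun y hy => fderiv_eulerKernel hy i), h.fderiv]
    simp [Pi.single_apply]
    simp only [hD, hl]
    ring
  simp only [lap, key, Finset.sum_add_distrib, Finset.sum_sub_distrib, ← Finset.mul_sum,
    Finset.sum_const, Finset.card_univ, Fintype.card_fin, nsmul_eq_mul]
  have hDs : ∑ i, (x i - v i) ^ 2 = D x := rfl
  have hls : ∑ i, v i * (x i - v i) = l x := rfl
  rw [hDs, hls]
  have e1 : D x ^ (-(N / 2) - 1 : ℝ) = D x ^ (-(N / 2) - 1 - 1 : ℝ) * D x := by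
    rw [← Real.rpow_add_one hDx]
    ring_nf
  have e2 : D x ^ (-(N / 2) : ℝ) = D x ^ (-(N / 2) - 1 - 1 : ℝ) * D x * D x := by
    rw [← e1, ← Real.rpow_add_one hDx]
    ring_nf
  rw [e2, e1]
  ring

theorem abs_eulerKernel_le {v x : Fin N → ℝ} {M s : ℝ} (hN : 2 ≤ N) (hM : ∀ j, |v j| ≤ M)
    (hs : 0 < s) (hx : s ≤ ∑ j, (x j - v j) ^ 2) :
    |eulerKernel v x| ≤ N / 2 * s ^ (1 - N / 2 : ℝ) +
      (N / 2 - 1) * (N * M) * s ^ (1 / 2 - N / 2 : ℝ) := by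
  set D := ∑ j, (x j - v j) ^ 2 with hD
  have hN2 : (2 : ℝ) ≤ N := by exact_mod_cast hN
  have hDpos : 0 < D := hs.trans_le hx
  have hM0 : 0 ≤ M := (abs_nonneg _).trans (hM ⟨0, by omega⟩)
  have hl : |∑ j, v j * (x j - v j)| ≤ N * M * D ^ (1 / 2 : ℝ) := by
    refine (Finset.abs_sum_le_sum_abs _ _).trans ?_
    calc ∑ j, |v j * (x j - v j)| ≤ ∑ _j : Fin N, M * D ^ (1 / 2 : ℝ) := by
          refine Finset.sum_le_sum fun j _ => ?_
          rw [abs_mul, ← Real.sqrt_eq_rpow]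
          refine mul_le_mul (hM j) (Real.abs_le_sqrt ?_) (abs_nonneg _) hM0
          exact Finset.single_le_sum (f := fun j => (x j - v j) ^ 2) (fun j _ => sq_nonneg _)
            (Finset.mem_univ j)
      _ = N * M * D ^ (1 / 2 : ℝ) := by simp [mul_assoc]
  have hp := Real.rpow_pos_of_pos hDpos (-(N / 2) : ℝ)
  have e1 : D ^ (1 - N / 2 : ℝ) = D ^ (-(N / 2) : ℝ) * D := by
    rw [← Real.rpow_add_one hDpos.ne']
    ring_nf
  have e2 : D ^ (1 / 2 - N / 2 : ℝ) = D ^ (-(N / 2) : ℝ) * D ^ (1 / 2 : ℝ) := by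
    rw [← Real.rpow_add hDpos]
    ring_nf
  calc |eulerKernel v x| ≤ D ^ (-(N / 2) : ℝ) *
          (N / 2 * D + (N / 2 - 1) * (N * M * D ^ (1 / 2 : ℝ))) := by
        rw [eulerKernel, abs_mul, abs_of_pos hp]
        refine mul_le_mul_of_nonneg_left ((abs_add_le _ _).trans (add_le_add ?_ ?_)) hp.le
        · rw [abs_of_nonneg (by positivity)]
        · rw [abs_mul, abs_of_nonneg (by linarith : 0 ≤ (N / 2 - 1 : ℝ))]
          exact mul_le_mul_of_nonneg_left hl (by linarith)
    _ = N / 2 * D ^ (1 - N / 2 : ℝ) + (N / 2 - 1) * (N * M) * D ^ (1 / 2 - N / 2 : ℝ) := by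
        rw [e1, e2]
        ring
    _ ≤ _ := by
        have h1 : D ^ (1 - N / 2 : ℝ) ≤ s ^ (1 - N / 2 : ℝ) :=
          Real.rpow_le_rpow_of_nonpos hs hx (by linarith)
        have h2 : D ^ (1 / 2 - N / 2 : ℝ) ≤ s ^ (1 / 2 - N / 2 : ℝ) :=
          Real.rpow_le_rpow_of_nonpos hs hx (by linarith)
        have h3 : 0 ≤ (N / 2 - 1 : ℝ) * (N * M) := mul_nonneg (by linarith) (by positivity)
        gcongr

theorem contDiffAt_eulerKernel {X : Type*} [NormedAddCommGroup X] [NormedSpace ℝ X]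
    {v x : X → Fin N → ℝ} {p : X} (hv : ContDiffAt ℝ ∞ v p) (hx : ContDiffAt ℝ ∞ x p)
    (h : ∑ j, (x p j - v p j) ^ 2 ≠ 0) : ContDiffAt ℝ ∞ (fun p => eulerKernel (v p) (x p)) p := by
  unfold eulerKernel
  rw [contDiffAt_pi] at hv hx
  have hD : ContDiffAt ℝ ∞ (fun p => ∑ j, (x p j - v p j) ^ 2) p :=
    ContDiffAt.sum fun j _ => ((hx j).sub (hv j)).pow 2
  exact (hD.rpow_const_of_ne h).mul ((contDiffAt_const.mul hD).add (contDiffAt_const.mul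
    (ContDiffAt.sum fun j _ => (hv j).mul ((hx j).sub (hv j)))))

end Kernel

section EulerPotential

open scoped ContDiff

variable {N : ℕ}

local notation "𝔼" => EuclideanSpace ℝ (Fin N)

/-- The set of points outside the image of the closed unit ball under the diagonal map with
entries `c`. -/
def exteriorDomain (c : Fin N → ℝ) : Set (Fin N → ℝ) :=
  {x | ∀ z ∈ Metric.closedBall (0 : 𝔼) 1, diagSqDist c x z ≠ 0}

/-- The function `u - ½ x · ∇u`, for the Newtonian potential `u` of the image of Lebesgue measure on
the unit ball under the diagonal map with entries `c`. -/
noncomputable def eulerPotential (c x : Fin N → ℝ) : ℝ :=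
  ∫ z in Metric.closedBall (0 : 𝔼) 1, eulerKernel (fun j => c j * z j) x

theorem isOpen_exteriorDomain (c : Fin N → ℝ) : IsOpen (exteriorDomain c) := by
  have : exteriorDomain c =
      ((fun (z : 𝔼) j => c j * z j) '' Metric.closedBall (0 : 𝔼) 1)ᶜ := by
    ext x
    simp only [exteriorDomain, diagSqDist_ne_zero_iff, mem_compl_iff, mem_image, not_exists,
      not_and, mem_ofPred_eq, funext_iff, not_forall, eq_comm]
  rw [this]
  exact ((isCompact_closedBall _ _).image (by fun_prop)).isClosed.isOpen_compl

theorem contDiffAt_uncurry_eulerKernel {c x : Fin N → ℝ} {z : 𝔼} (h : diagSqDist c x z ≠ 0) :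
    ContDiffAt ℝ ∞ (Function.uncurry fun (x : Fin N → ℝ) (z : 𝔼) =>
      eulerKernel (fun j => c j * z j) x) (x, z) :=
  contDiffAt_eulerKernel (v := fun p : (Fin N → ℝ) × 𝔼 => fun j => c j * p.2 j)
    (x := fun p => p.1) (by fun_prop) contDiffAt_fst h

theorem contDiffAt_uncurry_diagSqDist_rpow {c x : Fin N → ℝ} {z : 𝔼} (h : diagSqDist c x z ≠ 0)
    (q : ℝ) : ContDiffAt ℝ ∞ (Function.uncurry fun (x : Fin N → ℝ) (z : 𝔼) =>
      diagSqDist c x z ^ q) (x, z) := by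
  refine ContDiffAt.rpow_const_of_ne (f := fun p : (Fin N → ℝ) × 𝔼 => diagSqDist c p.1 p.2) ?_ h
  unfold diagSqDist
  fun_prop

theorem hasFDerivAt_ballPotential {c x : Fin N → ℝ} (hx : x ∈ exteriorDomain c) :
    HasFDerivAt (ballPotential c) (∫ z in Metric.closedBall (0 : 𝔼) 1,
      fderiv ℝ (fun x => diagSqDist c x z ^ (1 - N / 2 : ℝ)) x) x :=
  hasFDerivAt_setIntegral_of_contDiffAt (isOpen_exteriorDomain c) (isCompact_closedBall _ _)
    (fun _ hx _ hz => contDiffAt_uncurry_diagSqDist_rpow (hx _ hz) _) hx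

theorem fderiv_setIntegral_apply {Y H : Type} [NormedAddCommGroup Y] [NormedSpace ℝ Y]
    [NormedAddCommGroup H] [NormedSpace ℝ H] [MeasurableSpace Y] [OpensMeasurableSpace Y]
    {ν : Measure Y} [IsFiniteMeasureOnCompacts ν] {S : Set Y} {U : Set H} (hU : IsOpen U)
    (hS : IsCompact S) {f : H → Y → ℝ}
    (hf : ∀ x ∈ U, ∀ y ∈ S, ContDiffAt ℝ ∞ (Function.uncurry f) (x, y)) {x : H} (hx : x ∈ U)
    (e : H) :
    IntegrableOn (fun y => fderiv ℝ (fun x => f x y) x e) S ν ∧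
    fderiv ℝ (fun x => ∫ y in S, f x y ∂ν) x e = ∫ y in S, fderiv ℝ (fun x => f x y) x e ∂ν := by
  have hc : IntegrableOn (fun y => fderiv ℝ (fun x => f x y) x) S ν := by
    refine ContinuousOn.integrableOn_compact' hS hS.measurableSet fun y hy => ?_
    exact ((contDiffAt_uncurry_fderiv_left (hf x hx y hy)).continuousAt.comp
      (f := fun y => (x, y)) (by fun_prop)).continuousWithinAt
  refine ⟨hc.apply_continuousLinearMap e, ?_⟩
  rw [(hasFDerivAt_setIntegral_of_contDiffAt hU hS hf hx).fderiv,
    ContinuousLinearMap.integral_apply hc]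

theorem ballPotential_sub_half_sum_fderiv {c x : Fin N → ℝ} (hx : x ∈ exteriorDomain c) :
    ballPotential c x - 1 / 2 * ∑ i, x i * fderiv ℝ (ballPotential c) x (Pi.single i 1) =
      eulerPotential c x := by
  have hf : ∀ x ∈ exteriorDomain c, ∀ z ∈ Metric.closedBall (0 : 𝔼) 1,
      ContDiffAt ℝ ∞ (Function.uncurry fun (x : Fin N → ℝ) (z : 𝔼) =>
        diagSqDist c x z ^ (1 - N / 2 : ℝ)) (x, z) :=
    fun _ hx _ hz => contDiffAt_uncurry_diagSqDist_rpow (hx _ hz) _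
  have hd := fun i => fderiv_setIntegral_apply (ν := volume) (isOpen_exteriorDomain c)
    (isCompact_closedBall _ _) hf hx (Pi.single i 1)
  have hi : IntegrableOn (fun z : 𝔼 => diagSqDist c x z ^ (1 - N / 2 : ℝ))
      (Metric.closedBall 0 1) :=
    ContinuousOn.integrableOn_compact (isCompact_closedBall _ _) fun z hz =>
      ((hf x hx z hz).continuousAt.comp (f := fun z => (x, z)) (by fun_prop)).continuousWithinAt
  have e : ∀ i, fderiv ℝ (ballPotential c) x (Pi.single i 1) = _ := fun i => (hd i).2
  simp only [e, ← integral_const_mul]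
  rw [← integral_finsetSum _ fun i _ => (hd i).1.const_mul (x i), ← integral_const_mul,
    ballPotential, ← integral_sub hi
      ((integrable_finsetSum _ fun i _ => (hd i).1.const_mul (x i)).const_mul _)]
  exact setIntegral_congr_fun measurableSet_closedBall fun z hz =>
    sub_half_sum_fderiv_eq_eulerKernel (hx z hz)

theorem contDiffOn_eulerPotential (c : Fin N → ℝ) (n : ℕ) :
    ContDiffOn ℝ n (eulerPotential c) (exteriorDomain c) :=
  contDiffOn_setIntegral (isOpen_exteriorDomain c) (isCompact_closedBall _ _) n
    fun _ hx _ hz => contDiffAt_uncurry_eulerKernel (hx _ hz)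

theorem lap_eulerPotential {c x : Fin N → ℝ} (hx : x ∈ exteriorDomain c) :
    lap (eulerPotential c) x = 0 := by
  have hU := isOpen_exteriorDomain c
  have hf : ∀ x ∈ exteriorDomain c, ∀ z ∈ Metric.closedBall (0 : 𝔼) 1,
      ContDiffAt ℝ ∞ (Function.uncurry fun (x : Fin N → ℝ) (z : 𝔼) =>
        eulerKernel (fun j => c j * z j) x) (x, z) :=
    fun _ hx _ hz => contDiffAt_uncurry_eulerKernel (hx _ hz)
  have hf' : ∀ i, ∀ x ∈ exteriorDomain c, ∀ z ∈ Metric.closedBall (0 : 𝔼) 1,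
      ContDiffAt ℝ ∞ (Function.uncurry fun (x : Fin N → ℝ) (z : 𝔼) =>
        fderiv ℝ (eulerKernel fun j => c j * z j) x (Pi.single i 1)) (x, z) :=
    fun i x hx z hz => (contDiffAt_uncurry_fderiv_left (hf x hx z hz)).clm_apply contDiffAt_const
  have hd := fun i => fderiv_setIntegral_apply (ν := volume) hU (isCompact_closedBall _ _)
    (hf' i) hx (Pi.single i 1)
  have e : ∀ i, fderiv ℝ (fun y => fderiv ℝ (eulerPotential c) y (Pi.single i 1)) x
      (Pi.single i 1) = ∫ z in Metric.closedBall (0 : 𝔼) 1,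
        fderiv ℝ (fun y => fderiv ℝ (eulerKernel fun j => c j * z j) y (Pi.single i 1)) x
          (Pi.single i 1) := by
    intro i
    rw [← (hd i).2]
    refine congrArg (fun L : (Fin N → ℝ) →L[ℝ] ℝ => L (Pi.single i 1))
      (Filter.EventuallyEq.fderiv_eq ?_)
    filter_upwards [hU.mem_nhds hx] with y hy
    exact (fderiv_setIntegral_apply hU (isCompact_closedBall _ _) hf hy (Pi.single i 1)).2
  rw [lap, Finset.sum_congr rfl fun i _ => e i, ← integral_finsetSum _ fun i _ => (hd i).1]
  exact (setIntegral_congr_fun measurableSet_closedBall fun z hz =>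
    lap_eulerKernel (hx z hz)).trans (by simp)

theorem abs_mul_apply_le_norm {c : Fin N → ℝ} {z : 𝔼} (hz : z ∈ Metric.closedBall (0 : 𝔼) 1)
    (j : Fin N) : |c j * z j| ≤ ‖c‖ := by
  rw [abs_mul, ← mul_one ‖c‖]
  exact mul_le_mul (norm_le_pi_norm c j)
    ((PiLp.norm_apply_le z j).trans (mem_closedBall_zero_iff.1 hz)) (abs_nonneg _) (norm_nonneg _)

theorem le_diagSqDist [Nonempty (Fin N)] {c x : Fin N → ℝ} {M : ℝ} {z : 𝔼}
    (hM : ∀ j, |c j * z j| ≤ M) (hx : M ≤ ‖x‖) : (‖x‖ - M) ^ 2 ≤ diagSqDist c x z := by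
  rw [← Real.le_sqrt (by linarith) (diagSqDist_nonneg c x z), sub_le_iff_le_add,
    pi_norm_le_iff_of_nonempty]
  intro j
  have h1 : |x j - c j * z j| ≤ √(diagSqDist c x z) := Real.abs_le_sqrt
    (Finset.single_le_sum (f := fun j => (x j - c j * z j) ^ 2) (fun j _ => sq_nonneg _)
      (Finset.mem_univ j))
  have h2 := abs_sub_abs_le_abs_sub (x j) (c j * z j)
  rw [Real.norm_eq_abs]
  linarith [hM j]

theorem eventually_mem_exteriorDomain (hN : 0 < N) (c : Fin N → ℝ) :
    ∀ᶠ x in cocompact (Fin N → ℝ), x ∈ exteriorDomain c := by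
  have : Nonempty (Fin N) := ⟨⟨0, hN⟩⟩
  filter_upwards [(tendsto_norm_cocompact_atTop (E := Fin N → ℝ)).eventually_gt_atTop ‖c‖]
    with x hx z hz
  refine (lt_of_lt_of_le ?_ (le_diagSqDist (abs_mul_apply_le_norm hz) hx.le)).ne'
  exact pow_pos (sub_pos.2 hx) 2

theorem tendsto_eulerPotential_cocompact (hN : 3 ≤ N) (c : Fin N → ℝ) :
    Tendsto (eulerPotential c) (cocompact (Fin N → ℝ)) (𝓝 0) := by
  have : Nonempty (Fin N) := ⟨⟨0, by omega⟩⟩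
  have hN3 : (3 : ℝ) ≤ N := by exact_mod_cast hN
  set K := volume.real (Metric.closedBall (0 : 𝔼) 1)
  have hs : Tendsto (fun x : Fin N → ℝ => (‖x‖ - ‖c‖) ^ 2) (cocompact _) atTop :=
    (tendsto_pow_atTop two_ne_zero).comp
      (tendsto_atTop_add_const_right _ (-‖c‖) tendsto_norm_cocompact_atTop)
  have hlim : Tendsto (fun s : ℝ => (N / 2 * s ^ (1 - N / 2 : ℝ) +
      (N / 2 - 1) * (N * ‖c‖) * s ^ (1 / 2 - N / 2 : ℝ)) * K) atTop (𝓝 0) := by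
    have h1 := tendsto_rpow_neg_atTop (y := (N / 2 - 1 : ℝ)) (by linarith)
    have h2 := tendsto_rpow_neg_atTop (y := (N / 2 - 1 / 2 : ℝ)) (by linarith)
    simp only [neg_sub] at h1 h2
    simpa using ((h1.const_mul (N / 2 : ℝ)).add
      (h2.const_mul ((N / 2 - 1) * (N * ‖c‖)))).mul_const K
  refine squeeze_zero_norm' ?_ (hlim.comp hs)
  filter_upwards [(tendsto_norm_cocompact_atTop (E := Fin N → ℝ)).eventually_gt_atTop ‖c‖]
    with x hx
  refine norm_setIntegral_le_of_norm_le_const (isCompact_closedBall _ _).measure_lt_top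
    fun z hz => ?_
  exact abs_eulerKernel_le (by omega) (abs_mul_apply_le_norm hz) (pow_pos (sub_pos.2 hx) 2)
    (le_diagSqDist (abs_mul_apply_le_norm hz) hx.le)

/-- On the boundary of a confocal ellipsoid the Euler potential is constant. -/
theorem eulerPotential_sqrt_mul (hN : 0 < N) {b : Fin N → ℝ} (hb : ∀ j, 0 ≤ b j) {t : ℝ}
    (ht : 0 < t) {η : 𝔼} (hη : ‖η‖ = 1) :
    eulerPotential (fun j => √(b j)) (fun j => √(b j + t) * η j) =
      1 / 2 * shellPotential (fun j => √(b j + t)) 0 := by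
  set c : Fin N → ℝ := fun j => √(b j) with hc
  set x : Fin N → ℝ := fun j => √(b j + t) * η j with hx
  have hxU : x ∈ exteriorDomain c := by
    intro z hz
    simpa [hc, hx] using diagSqDist_sqrt_mul_ne_zero hb le_rfl ht hη.ge
      (mem_closedBall_zero_iff.1 hz)
  have hsum : ∑ i, x i * fderiv ℝ (ballPotential c) x (Pi.single i 1) =
      2 * ballPotential c x - shellPotential c x := by
    have h1 : ∑ i, x i * fderiv ℝ (ballPotential c) x (Pi.single i 1) =
        fderiv ℝ (ballPotential c) x x := by
      generalize fderiv ℝ (ballPotential c) x = L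
      conv_rhs => rw [pi_eq_sum_univ' x]
      simp
    have h2 : HasDerivAt (fun t : ℝ => t • x) x 1 := by
      simpa using (hasDerivAt_id (1 : ℝ)).smul_const x
    have h3 : HasFDerivAt (ballPotential c) (fderiv ℝ (ballPotential c) x) ((1 : ℝ) • x) := by
      rw [one_smul]
      exact (hasFDerivAt_ballPotential hxU).differentiableAt.hasFDerivAt
    have h4 : HasDerivAt (fun t : ℝ => ballPotential c (t • x))
        (fderiv ℝ (ballPotential c) x x) 1 :=
      HasFDerivAt.comp_hasDerivAt (f := fun t : ℝ => t • x) 1 h3 h2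
    rw [h1]
    exact h4.unique (hasDerivAt_ballPotential_smul hN hxU)
  rw [← ballPotential_sub_half_sum_fderiv hxU, hsum, ← shellPotential_sqrt_mul_eq_zero hN hb ht hη]
  ring

end EulerPotential

section Exterior

theorem exteriorDomain_eq_compl {n : ℕ} {b : Fin n → ℝ} (hb : ∀ j, 0 < b j)
    {c : Fin (n + 1) → ℝ} (hc : ∀ j : Fin n, c j.castSucc = √(b j)) (hlast : c (Fin.last n) = 0) :
    exteriorDomain c = {y | y (Fin.last n) = 0 ∧ ∑ j : Fin n, y j.castSucc ^ 2 / b j ≤ 1}ᶜ := by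
  ext x
  rw [← not_iff_not, mem_compl_iff, not_not]
  simp only [exteriorDomain, diagSqDist_ne_zero_iff, mem_ofPred_eq, not_forall, not_exists,
    not_not, mem_closedBall_zero_iff, exists_prop, EuclideanSpace.norm_eq, Real.sqrt_le_one,
    Fin.forall_fin_succ', hc, hlast, zero_mul, Fin.sum_univ_castSucc, Real.norm_eq_abs, sq_abs]
  constructor
  · rintro ⟨z, hz, h, h0⟩
    refine ⟨h0, ?_⟩
    have : ∑ j : Fin n, x j.castSucc ^ 2 / b j = ∑ j : Fin n, z j.castSucc ^ 2 :=
      Finset.sum_congr rfl fun j _ => by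
        rw [h j, mul_pow, Real.sq_sqrt (hb j).le, mul_div_cancel_left₀ _ (hb j).ne']
    rw [this]
    nlinarith [sq_nonneg (z (Fin.last n))]
  · rintro ⟨h0, h⟩
    refine ⟨WithLp.toLp 2 (Fin.snoc (fun j : Fin n => x j.castSucc / √(b j)) 0), ?_, ?_, h0⟩
    · simpa [div_pow, Real.sq_sqrt (hb _).le] using h
    · intro j
      simp [mul_div_cancel₀ _ (Real.sqrt_pos.2 (hb j)).ne']

theorem potential_sub_half_sum_fderiv {N : ℕ} {c : Fin N → ℝ} {u : (Fin N → ℝ) → ℝ} {K : ℝ}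
    (hu : ∀ x ∈ exteriorDomain c, u x = K * ballPotential c x) {x : Fin N → ℝ}
    (hx : x ∈ exteriorDomain c) :
    u x - 1 / 2 * ∑ i, x i * fderiv ℝ u x (Pi.single i 1) = K * eulerPotential c x := by
  have h : fderiv ℝ u x = K • fderiv ℝ (ballPotential c) x := by
    rw [(Filter.eventuallyEq_of_mem ((isOpen_exteriorDomain c).mem_nhds hx) hu).fderiv_eq]
    exact fderiv_const_mul (hasFDerivAt_ballPotential hx).differentiableAt K
  rw [hu x hx, h, ← ballPotential_sub_half_sum_fderiv hx, mul_sub]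
  simp only [FunLike.coe_smul, Pi.smul_apply, smul_eq_mul, Finset.mul_sum]
  congr 1
  exact Finset.sum_congr rfl fun i _ => by ring

theorem lap_const_smul {N : ℕ} (K : ℝ) (u : (Fin N → ℝ) → ℝ) (x : Fin N → ℝ) :
    lap (K • u) x = K * lap u x := by
  have h : ∀ i, (fun y => fderiv ℝ (K • u) y (Pi.single i 1)) =
      K • fun y => fderiv ℝ u y (Pi.single i 1) := fun i => by
    rw [fderiv_const_smul_field]
    rfl
  rw [lap, lap, Finset.mul_sum]
  refine Finset.sum_congr rfl fun i _ => ?_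
  rw [h, fderiv_const_smul_field]
  rfl

theorem lap_congr {N : ℕ} {u v : (Fin N → ℝ) → ℝ} {x : Fin N → ℝ} (h : u =ᶠ[𝓝 x] v) :
    lap u x = lap v x := by
  refine Finset.sum_congr rfl fun i _ => ?_
  rw [Filter.EventuallyEq.fderiv_eq]
  filter_upwards [h.fderiv (𝕜 := ℝ)] with y hy
  rw [hy]

theorem measure_sum_sq_le_one_pos (N : ℕ) :
    0 < (volume {x : Fin N → ℝ | ∑ j, x j ^ 2 ≤ 1}).toReal := by
  have h : {x : Fin N → ℝ | ∑ j, x j ^ 2 ≤ 1} =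
      WithLp.toLp 2 ⁻¹' Metric.closedBall (0 : EuclideanSpace ℝ (Fin N)) 1 := by
    ext x
    simp [EuclideanSpace.norm_eq]
  rw [h, (PiLp.volume_preserving_toLp (Fin N)).measure_preimage
    measurableSet_closedBall.nullMeasurableSet]
  exact ENNReal.toReal_pos (Metric.measure_closedBall_pos _ _ one_pos).ne'
    (isCompact_closedBall _ _).measure_lt_top.ne

end Exterior

end Preliminaries

/-- **Corollary 3.2**: for the ellipsoid `Ω = {x : Σ xⱼ²/aⱼ² ≤ 1}` (`a₁ > ⋯ > a_N > 0`,
`N ≥ 3`), with `B = C_N ∫_Ω |y|^{2−N}dy`, `μ` the mother body measure on the focal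
ellipsoid `E`, and `μ̂(x) = C_N ∫_E |x−y|^{2−N} dμ(y)`, the function
`V(x) = (1/B)(μ̂(x) − ½ Σ xᵢ ∂μ̂/∂xᵢ(x))` is (i) harmonic off `E`, (ii) equal to `1` on
`Γ = ∂Ω`, and (iii) tends to `0` at infinity; i.e. `V` is the equilibrium potential of `Ω`. -/
theorem equilibrium_potential_of_ellipsoid
    (N : ℕ) (hN : 3 ≤ N) (a : Fin N → ℝ) (hpos : ∀ j, 0 < a j)
    (hstrict : ∀ i j : Fin N, i < j → a j < a i) :
    let lN : Fin N := ⟨N - 1, by omega⟩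
    let cast : Fin (N - 1) → Fin N := Fin.castLE (by omega)
    let emb : (Fin (N - 1) → ℝ) → (Fin N → ℝ) :=
      fun y' i => if h : (i : ℕ) < N - 1 then y' ⟨i, h⟩ else 0
    let ρ : (Fin (N - 1) → ℝ) → ℝ := fun y' =>
      2 * (∏ j, a j) *
        (∏ j : Fin (N - 1), ((a (cast j)) ^ 2 - (a lN) ^ 2)) ^ (-(1 / 2) : ℝ) *
        Real.sqrt (1 - ∑ j, (y' j) ^ 2 / ((a (cast j)) ^ 2 - (a lN) ^ 2))
    let E' : Set (Fin (N - 1) → ℝ) :=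
      {y' | ∑ j, (y' j) ^ 2 / ((a (cast j)) ^ 2 - (a lN) ^ 2) ≤ 1}
    let E : Set (Fin N → ℝ) :=
      {y | y lN = 0 ∧ ∑ j, (y (cast j)) ^ 2 / ((a (cast j)) ^ 2 - (a lN) ^ 2) ≤ 1}
    let Ω : Set (Fin N → ℝ) := {x | ∑ j, (x j) ^ 2 / (a j) ^ 2 ≤ 1}
    let C : ℝ := 1 / ((N : ℝ) * (volume {x : Fin N → ℝ | ∑ j, (x j) ^ 2 ≤ 1}).toReal)
    let B : ℝ := C * ∫ y in Ω, Real.sqrt (∑ j, (y j) ^ 2) ^ (2 - (N : ℤ))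
    let muHat : (Fin N → ℝ) → ℝ := fun x =>
      C * ∫ y' in E', ρ y' * Real.sqrt (∑ i, (x i - emb y' i) ^ 2) ^ (2 - (N : ℤ))
    let V : (Fin N → ℝ) → ℝ := fun x =>
      (1 / B) * (muHat x - (1 / 2) * ∑ i, x i * fderiv ℝ muHat x (Pi.single i 1))
    (ContDiffOn ℝ 2 V Eᶜ ∧ ∀ x ∈ (Eᶜ : Set (Fin N → ℝ)), lap V x = 0) ∧
      (∀ x : Fin N → ℝ, ∑ j, (x j) ^ 2 / (a j) ^ 2 = 1 → V x = 1) ∧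
      Filter.Tendsto V (Filter.cocompact (Fin N → ℝ)) (nhds 0) := by
  obtain ⟨n, rfl⟩ : ∃ n, N = n + 1 := ⟨N - 1, by omega⟩
  intro lN cast emb ρ E' E Ω C B muHat V
  set b : Fin (n + 1) → ℝ := fun j => a j ^ 2 - a (Fin.last n) ^ 2 with hb
  set c : Fin (n + 1) → ℝ := fun j => √(b j) with hc
  have hτ : 0 < a (Fin.last n) ^ 2 := pow_pos (hpos _) 2
  have hbpos : ∀ j : Fin n, 0 < b j.castSucc := fun j =>
    sub_pos.2 (pow_lt_pow_left₀ (hstrict _ _ (Fin.castSucc_lt_last j)) (hpos _).le two_ne_zero)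
  have hblast : b (Fin.last n) = 0 := sub_self _
  have hbnonneg : ∀ j, 0 ≤ b j := by
    rw [Fin.forall_fin_succ']
    exact ⟨fun j => (hbpos j).le, hblast.ge⟩
  have hba : ∀ j, √(b j + a (Fin.last n) ^ 2) = a j := fun j => by
    rw [hb, sub_add_cancel, Real.sqrt_sq (hpos j).le]
  have hclast : c (Fin.last n) = 0 := by simp [hc, hblast]
  have hE : Eᶜ = exteriorDomain c := (exteriorDomain_eq_compl hbpos (fun _ => rfl) hclast).symm
  have hmu : ∀ x ∈ exteriorDomain c, muHat x = C * (∏ j, a j) * ballPotential c x := by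
    intro x hx
    rw [mul_assoc, ← setIntegral_focalEllipsoid_eq_ballPotential hbpos (∏ j, a j) (fun _ => rfl)
      hclast hx]
    rfl
  have hBval : B = C * ((∏ j, a j) * (1 / 2 * shellPotential a 0)) := by
    rw [← ballPotential_zero (by omega), ← setIntegral_ellipsoid_eq_ballPotential hpos]
  have hC : C ≠ 0 := by
    have := measure_sum_sq_le_one_pos (n + 1)
    positivity
  have hV : ∀ x ∈ exteriorDomain c,
      V x = ((1 / B * (C * ∏ j, a j)) • eulerPotential c) x := by
    intro x hx
    rw [Pi.smul_apply, smul_eq_mul, mul_assoc, ← potential_sub_half_sum_fderiv hmu hx]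
  rw [hE]
  refine ⟨⟨(ContDiffOn.const_smul (1 / B * (C * ∏ j, a j))
    (contDiffOn_eulerPotential c 2)).congr hV, fun x hx => ?_⟩, fun x hx => ?_, ?_⟩
  · rw [lap_congr (Filter.eventuallyEq_of_mem ((isOpen_exteriorDomain c).mem_nhds hx) hV),
      lap_const_smul, lap_eulerPotential hx, mul_zero]
  · set η : EuclideanSpace ℝ (Fin (n + 1)) := WithLp.toLp 2 fun j => x j / a j
    have hη : ‖η‖ = 1 := by simp [η, EuclideanSpace.norm_eq, div_pow, hx]
    have hxη : x = fun j => √(b j + a (Fin.last n) ^ 2) * η j := by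
      ext j
      simp [hba, η, mul_div_cancel₀ _ (hpos j).ne']
    have hmem : x ∈ exteriorDomain c := by
      intro z hz
      have := diagSqDist_sqrt_mul_ne_zero hbnonneg le_rfl hτ hη.ge (mem_closedBall_zero_iff.1 hz)
      rw [hxη]
      simpa [hc] using this
    have hval : eulerPotential c x = 1 / 2 * shellPotential a 0 := by
      rw [hxη, eulerPotential_sqrt_mul (by omega) hbnonneg hτ hη]
      simp only [hba]
    have hS : 0 < shellPotential a 0 := shellPotential_pos (by omega) fun z hz => by
      rw [diagSqDist_ne_zero_iff]
      by_contra! h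
      have hz0 : z = 0 := by
        ext j
        simpa [(hpos j).ne'] using h j
      simp [hz0] at hz
    have hP : 0 < ∏ j, a j := Finset.prod_pos fun j _ => hpos j
    rw [hV x hmem, Pi.smul_apply, hval, hBval, smul_eq_mul]
    field_simp
  · have h := (tendsto_eulerPotential_cocompact hN c).const_smul (1 / B * (C * ∏ j, a j))
    rw [smul_zero] at h
    refine h.congr' ?_
    filter_upwards [eventually_mem_exteriorDomain (by omega) c] with x hx
    exact (hV x hx).symm
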